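/- Let G be a finite simple Δ-regular graph with Δ ≥ 39 and chromatic number χ(G) ≤ Δ/4, and let m be an odd integer and n an integer with 1 < m < n. Then χ(G^{m/n}) = ω(G^{m/n}). -/

import Mathlib

open SimpleGraph

/-- Representations of vertices of the `n`-subdivision of `G`: `(u, u, 0)` represents the
branch vertex `u`, and for an adjacent pair `(u, v)`, the triple `(u, v, i)` with `i ≤ n`
represents the point at distance `i` from `u` on the path of length `n` replacing the
edge `uv`. -/
def SubdivPre {V : Type*} (G : SimpleGraph V) (n : ℕ) : Type _ :=
  {p : V × V × ℕ // (p.1 = p.2.1 ∧ p.2.2 = 0) ∨ (G.Adj p.1 p.2.1 ∧ p.2.2 ≤ n)}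

/-- The identifications between representations: `(u, v, i)` and `(v, u, n - i)` represent
the same point, and `(u, v, 0)` represents the branch vertex `u`, i.e. `(u, u, 0)`. -/
inductive SubdivRel {V : Type*} (G : SimpleGraph V) (n : ℕ) :
    SubdivPre G n → SubdivPre G n → Prop
  | flip (u v : V) (i : ℕ) (h : G.Adj u v) (hi : i ≤ n) :
      SubdivRel G n ⟨(u, v, i), Or.inr ⟨h, hi⟩⟩
        ⟨(v, u, n - i), Or.inr ⟨h.symm, Nat.sub_le n i⟩⟩
  | collapse (u v : V) (h : G.Adj u v) :
      SubdivRel G n ⟨(u, v, 0), Or.inr ⟨h, Nat.zero_le n⟩⟩ ⟨(u, u, 0), Or.inl ⟨rfl, rfl⟩⟩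

/-- The vertex set of the `n`-subdivision of `G`. -/
def SubdivVert {V : Type*} (G : SimpleGraph V) (n : ℕ) : Type _ := Quot (SubdivRel G n)

/-- The branch vertex of the subdivision corresponding to a vertex `u` of `G`. -/
def branchVertex {V : Type*} (G : SimpleGraph V) (n : ℕ) (u : V) : SubdivVert G n :=
  Quot.mk _ ⟨(u, u, 0), Or.inl ⟨rfl, rfl⟩⟩

/-- The vertex `(uv)_i` of the subdivision: the point at distance `i` from `u` on the
path of length `n` replacing the edge `uv`. -/
def mkVert {V : Type*} (G : SimpleGraph V) (n : ℕ) {u v : V} (h : G.Adj u v)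
    (i : ℕ) (hi : i ≤ n) : SubdivVert G n :=
  Quot.mk _ ⟨(u, v, i), Or.inr ⟨h, hi⟩⟩

/-- The `n`-subdivision `G^{1/n}` of `G`: each edge of `G` is replaced by a path of
length `n`; consecutive points on such a path are adjacent. -/
def subdivision {V : Type*} (G : SimpleGraph V) (n : ℕ) : SimpleGraph (SubdivVert G n) :=
  SimpleGraph.fromRel (fun x y => ∃ (u v : V) (h : G.Adj u v) (i : ℕ) (hi : i < n),
    x = mkVert G n h i (le_of_lt hi) ∧ y = mkVert G n h (i + 1) hi)

/-- The `m`-power of a graph: two distinct vertices are adjacent iff their distance is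
at most `m`, i.e. iff there is a walk of length at most `m` between them. -/
def powerGraph {W : Type*} (H : SimpleGraph W) (m : ℕ) : SimpleGraph W :=
  SimpleGraph.fromRel (fun x y => ∃ w : H.Walk x y, w.length ≤ m)

/-- The fractional power `G^{m/n}`, the `m`-power of the `n`-subdivision of `G`. -/
def fracPower {V : Type*} (G : SimpleGraph V) (m n : ℕ) : SimpleGraph (SubdivVert G n) :=
  powerGraph (subdivision G n) m


theorem orient_multi {V ι : Type*} [Fintype V] [DecidableEq V] [Fintype ι] [DecidableEq ι]
    (s t : ι → V) (d : ℕ)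
    (hdeg : ∀ v, (Finset.univ.filter (fun e => s e = v)).card
      + (Finset.univ.filter (fun e => t e = v)).card = 2 * d) :
    ∃ a : ι → V, (∀ e, a e = s e ∨ a e = t e) ∧
      ∀ v, (Finset.univ.filter (fun e => a e = v)).card = d := by
  classical
  have hall := (Finset.all_card_le_biUnion_card_iff_exists_injective
    (fun e : ι => (({s e, t e} : Finset V) ×ˢ (Finset.univ : Finset (Fin d))))).1 ?_
  · obtain ⟨f, hf, hm⟩ := hall
    have ha : ∀ e, (f e).1 = s e ∨ (f e).1 = t e := by
      intro e
      have := hm e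
      simpa [Finset.mem_product] using this
    refine ⟨fun e => (f e).1, ha, ?_⟩
    have hle : ∀ v ∈ (Finset.univ : Finset V),
        (Finset.univ.filter (fun e => (f e).1 = v)).card ≤ d := by
      intro v _
      have : (Finset.univ.filter (fun e => (f e).1 = v)).card
          ≤ (Finset.univ : Finset (Fin d)).card := by
        apply Finset.card_le_card_of_injOn (fun e => (f e).2) (by simp)
        intro x hx y hy hxy
        simp at hx hy
        exact hf (Prod.ext (hx.trans hy.symm) hxy)
      simpa using this
    have h1 : ∑ v : V, (Finset.univ.filter (fun e => (f e).1 = v)).card = Fintype.card ι := by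
      rw [← Finset.card_eq_sum_card_fiberwise (by intro x _; simp)]
      rfl
    have h2 : ∑ v : V, (Finset.univ.filter (fun e => s e = v)).card = Fintype.card ι := by
      rw [← Finset.card_eq_sum_card_fiberwise (by intro x _; simp)]
      rfl
    have h3 : ∑ v : V, (Finset.univ.filter (fun e => t e = v)).card = Fintype.card ι := by
      rw [← Finset.card_eq_sum_card_fiberwise (by intro x _; simp)]
      rfl
    have h4 : ∑ v : V, ((Finset.univ.filter (fun e => s e = v)).card
      + (Finset.univ.filter (fun e => t e = v)).card) = ∑ v : V, 2 * d :=
      Finset.sum_congr rfl (fun v _ => hdeg v)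
    rw [Finset.sum_add_distrib, h2, h3, ← Finset.mul_sum] at h4
    have h5 : ∑ v : V, (Finset.univ.filter (fun e => (f e).1 = v)).card = ∑ v : V, d := by
      rw [h1]; omega
    intro v
    exact (Finset.sum_eq_sum_iff_of_le hle).1 h5 v (Finset.mem_univ v)
  · intro F
    set W := F.image s ∪ F.image t with hW
    have hb : F.biUnion (fun e : ι => (({s e, t e} : Finset V) ×ˢ (Finset.univ : Finset (Fin d))))
        = W ×ˢ Finset.univ := by
      ext ⟨v, i⟩
      simp only [Finset.mem_biUnion, Finset.mem_product, Finset.mem_insert,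
        Finset.mem_singleton, Finset.mem_univ, and_true, hW, Finset.mem_union, Finset.mem_image]
      constructor
      · rintro ⟨e, he, h | h⟩
        · exact Or.inl ⟨e, he, h.symm⟩
        · exact Or.inr ⟨e, he, h.symm⟩
      · rintro (⟨e, he, h⟩ | ⟨e, he, h⟩)
        · exact ⟨e, he, Or.inl h.symm⟩
        · exact ⟨e, he, Or.inr h.symm⟩
    rw [hb, Finset.card_product]
    have h1 : F.card = ∑ v ∈ W, (F.filter (fun e => s e = v)).card :=
      Finset.card_eq_sum_card_fiberwise (by
        intro x hx; simp only [hW, Finset.coe_union, Finset.coe_image]; exact Or.inl ⟨x, hx, rfl⟩)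
    have h2 : F.card = ∑ v ∈ W, (F.filter (fun e => t e = v)).card :=
      Finset.card_eq_sum_card_fiberwise (by
        intro x hx; simp only [hW, Finset.coe_union, Finset.coe_image]; exact Or.inr ⟨x, hx, rfl⟩)
    have h3 : ∑ v ∈ W, ((F.filter (fun e => s e = v)).card + (F.filter (fun e => t e = v)).card)
        ≤ ∑ v ∈ W, 2 * d := by
      apply Finset.sum_le_sum
      intro v _
      rw [← hdeg v]
      gcongr <;> simp
    rw [Finset.sum_add_distrib, ← h1, ← h2, Finset.sum_const, smul_eq_mul] at h3
    simp only [Finset.card_univ, Fintype.card_fin]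
    nlinarith

theorem orient_half {V ι : Type*} [Fintype V] [DecidableEq V] [Fintype ι] [DecidableEq ι]
    (s t : ι → V) (D : ℕ)
    (hdeg : ∀ v, (Finset.univ.filter (fun e => s e = v)).card
      + (Finset.univ.filter (fun e => t e = v)).card = D) :
    ∃ a : ι → V, (∀ e, a e = s e ∨ a e = t e) ∧
      ∀ v, 2 * (Finset.univ.filter (fun e => a e = v)).card ≤ D + 1 ∧
        D ≤ 2 * (Finset.univ.filter (fun e => a e = v)).card + 1 := by
  classical
  rcases Nat.even_or_odd' D with ⟨d, hd | hd⟩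
  · obtain ⟨a, ha, h⟩ := orient_multi s t d (fun v => (hdeg v).trans hd)
    refine ⟨a, ha, fun v => ?_⟩
    rw [h v]; omega
  · have h2 : ∑ v : V, (Finset.univ.filter (fun e => s e = v)).card = Fintype.card ι := by
      rw [← Finset.card_eq_sum_card_fiberwise (by intro x _; simp)]
      rfl
    have h3 : ∑ v : V, (Finset.univ.filter (fun e => t e = v)).card = Fintype.card ι := by
      rw [← Finset.card_eq_sum_card_fiberwise (by intro x _; simp)]
      rfl
    have h4 : ∑ v : V, ((Finset.univ.filter (fun e => s e = v)).card
      + (Finset.univ.filter (fun e => t e = v)).card) = ∑ v : V, D :=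
      Finset.sum_congr rfl (fun v _ => hdeg v)
    rw [Finset.sum_add_distrib, h2, h3, Finset.sum_const, smul_eq_mul, Finset.card_univ] at h4
    have hev : Even (Fintype.card V) := by
      have : Even (Fintype.card V * D) := ⟨_, h4.symm⟩
      rcases Nat.even_mul.1 this with h | h
      · exact h
      · exfalso; rw [hd] at h; exact (Nat.not_even_iff_odd.2 ⟨d, rfl⟩) h
    obtain ⟨p, hp⟩ := hev
    have e : V ≃ Fin p × Bool := Fintype.equivOfCardEq (by simp [hp]; omega)
    have hcard : ∀ v, (Finset.univ.filter (fun i : Fin p => e.symm (i, false) = v)).card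
        + (Finset.univ.filter (fun i : Fin p => e.symm (i, true) = v)).card = 1 := by
      intro v
      obtain ⟨⟨i, b⟩, rfl⟩ := e.symm.surjective v
      cases b <;> simp [Finset.filter_eq']
    have hsum : ∀ (g : ι → V) (k : Fin p → V) (v : V),
        (Finset.univ.filter (fun x : ι ⊕ Fin p => Sum.elim g k x = v)).card
        = (Finset.univ.filter (fun e => g e = v)).card
          + (Finset.univ.filter (fun e => k e = v)).card := by
      intro g k v
      simp only [Finset.card_filter, Fintype.sum_sum_type, Sum.elim_inl, Sum.elim_inr]
      congr! 2
    obtain ⟨a, ha, h⟩ := orient_multi (Sum.elim s (fun i : Fin p => e.symm (i, false)))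
      (Sum.elim t (fun i : Fin p => e.symm (i, true))) (d + 1) (by
        intro v
        rw [hsum, hsum]
        have := hdeg v
        have := hcard v
        omega)
    refine ⟨fun x => a (Sum.inl x), fun x => ha (Sum.inl x), fun v => ?_⟩
    have h5 := h v
    have h6 : a = Sum.elim (fun x => a (Sum.inl x)) (fun x => a (Sum.inr x)) := by
      ext x; cases x <;> rfl
    rw [h6, hsum] at h5
    have h7 : (Finset.univ.filter (fun i : Fin p => a (Sum.inr i) = v)).card ≤ 1 := by
      rw [← hcard v, ← Finset.card_union_of_disjoint]
      · apply Finset.card_le_card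
        intro i hi
        simp only [Finset.mem_filter, Finset.mem_univ, true_and, Finset.mem_union] at hi ⊢
        have := ha (Sum.inr i)
        simp only [Sum.elim_inr] at this
        rw [hi] at this
        exact this.imp Eq.symm Eq.symm
      · rw [Finset.disjoint_left]
        intro i hi hj
        simp only [Finset.mem_filter, Finset.mem_univ, true_and] at hi hj
        have := e.symm.injective (hi.trans hj.symm)
        simp at this
    beta_reduce
    omega

theorem orient_graph {V : Type*} [Fintype V] [DecidableEq V] (G : SimpleGraph V)
    [DecidableRel G.Adj] (D : ℕ) (hreg : G.IsRegularOfDegree D) :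
    ∃ out : V → V → Bool, (∀ u v, G.Adj u v → out v u = !out u v) ∧
      ∀ v, 2 * (Finset.univ.filter (fun w => G.Adj v w ∧ out v w = true)).card ≤ D + 1 ∧
        D ≤ 2 * (Finset.univ.filter (fun w => G.Adj v w ∧ out v w = true)).card + 1 := by
  classical
  let e := Fintype.equivFin V
  let ι := {q : V × V // G.Adj q.1 q.2 ∧ e q.1 < e q.2}
  have hdeg : ∀ v, (Finset.univ.filter (fun q : ι => q.1.1 = v)).card
      + (Finset.univ.filter (fun q : ι => q.1.2 = v)).card = D := by
    intro v
    have h1 : (Finset.univ.filter (fun q : ι => q.1.1 = v)).card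
        = (Finset.univ.filter (fun w => G.Adj v w ∧ e v < e w)).card := by
      apply Finset.card_bij (fun q _ => q.1.2)
      · rintro ⟨⟨a, b⟩, h⟩ hq
        simp at hq ⊢
        subst hq; exact h
      · rintro ⟨⟨a, b⟩, h⟩ hq ⟨⟨a', b'⟩, h'⟩ hq' heq
        simp at hq hq' heq
        subst hq heq; simp [hq']
      · intro w hw
        simp at hw
        exact ⟨⟨(v, w), hw⟩, by simp, rfl⟩
    have h2 : (Finset.univ.filter (fun q : ι => q.1.2 = v)).card
        = (Finset.univ.filter (fun w => G.Adj v w ∧ e w < e v)).card := by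
      apply Finset.card_bij (fun q _ => q.1.1)
      · rintro ⟨⟨a, b⟩, h⟩ hq
        simp at hq ⊢
        subst hq; exact ⟨h.1.symm, h.2⟩
      · rintro ⟨⟨a, b⟩, h⟩ hq ⟨⟨a', b'⟩, h'⟩ hq' heq
        simp at hq hq' heq
        subst hq heq; simp [hq']
      · intro w hw
        simp at hw
        exact ⟨⟨(w, v), hw.1.symm, hw.2⟩, by simp, rfl⟩
    rw [h1, h2, ← hreg v, ← G.card_neighborFinset_eq_degree, ← Finset.card_union_of_disjoint]
    · congr 1
      ext w
      simp only [Finset.mem_union, Finset.mem_filter, Finset.mem_univ, true_and,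
        mem_neighborFinset]
      constructor
      · rintro (h | h) <;> exact h.1
      · intro h
        rcases lt_trichotomy (e v) (e w) with h' | h' | h'
        · exact Or.inl ⟨h, h'⟩
        · exact absurd (e.injective h') h.ne
        · exact Or.inr ⟨h, h'⟩
    · rw [Finset.disjoint_left]
      intro w hw hw'
      simp only [Finset.mem_filter, Finset.mem_univ, true_and] at hw hw'
      exact absurd hw.2 (lt_asymm hw'.2)
  obtain ⟨a, ha, hc⟩ := orient_half (fun q : ι => q.1.1) (fun q : ι => q.1.2) D hdeg
  let P : V → V → Prop := fun u v =>
    (∃ h : G.Adj u v ∧ e u < e v, a ⟨(u, v), h⟩ = u) ∨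
    (∃ h : G.Adj v u ∧ e v < e u, a ⟨(v, u), h⟩ = u)
  have hP1 : ∀ u v, G.Adj u v → e u < e v → (P v u ↔ ¬ P u v) := by
    intro u v h hlt
    have h0 := ha ⟨(u, v), h, hlt⟩
    have hne := h.ne
    simp only at h0
    constructor
    · rintro (⟨h', _⟩ | ⟨h', h1⟩)
      · exact absurd h'.2 (lt_asymm hlt)
      · rintro (⟨h'', h2⟩ | ⟨h'', h2⟩)
        · exact hne (h2.symm.trans h1)
        · exact absurd h''.2 (lt_asymm hlt)
    · intro hn
      rcases h0 with h0 | h0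
      · exact absurd (Or.inl ⟨⟨h, hlt⟩, h0⟩) hn
      · exact Or.inr ⟨⟨h, hlt⟩, h0⟩
  have hP : ∀ u v, G.Adj u v → (P v u ↔ ¬ P u v) := by
    intro u v h
    rcases lt_trichotomy (e u) (e v) with h' | h' | h'
    · exact hP1 u v h h'
    · exact absurd (e.injective h') h.ne
    · have := hP1 v u h.symm h'
      exact ⟨fun a b => this.1 b a, fun a => by by_contra c; exact a (this.2 c)⟩
  refine ⟨fun u v => decide (P u v), fun u v h => ?_, fun v => ?_⟩
  · have := hP u v h
    by_cases h1 : P u v <;> simp [h1, this]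
  · have hcard : (Finset.univ.filter (fun w => G.Adj v w ∧ decide (P v w) = true)).card
        = (Finset.univ.filter (fun q : ι => a q = v)).card := by
      symm
      apply Finset.card_bij (fun q _ => if q.1.1 = v then q.1.2 else q.1.1)
      · rintro ⟨⟨x, y⟩, h⟩ hq
        simp only [Finset.mem_filter, Finset.mem_univ, true_and, decide_eq_true_eq] at hq ⊢
        rcases ha ⟨(x, y), h⟩ with h0 | h0
        · have : x = v := h0.symm.trans hq
          subst this
          simp only [if_true]
          exact ⟨h.1, Or.inl ⟨h, hq⟩⟩
        · have : y = v := h0.symm.trans hq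
          subst this
          have hne := h.1.ne
          simp only at hne
          rw [if_neg hne]
          exact ⟨h.1.symm, Or.inr ⟨h, hq⟩⟩
      · rintro ⟨⟨x, y⟩, h⟩ hq ⟨⟨x', y'⟩, h'⟩ hq' heq
        simp only [Finset.mem_filter, Finset.mem_univ, true_and] at hq hq'
        have h0 := ha ⟨(x, y), h⟩
        have h0' := ha ⟨(x', y'), h'⟩
        rw [hq] at h0
        rw [hq'] at h0'
        have h2 := h.2
        have h2' := h'.2
        have hne := h.1.ne
        have hne' := h'.1.ne
        dsimp only at h0 h0' heq h2 h2' hne hne'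
        suffices hxy : x = x' ∧ y = y' by
          obtain ⟨rfl, rfl⟩ := hxy; rfl
        rcases h0 with rfl | rfl <;> rcases h0' with h0' | h0'
        · subst h0'; simpa using heq
        · subst h0'
          rw [if_pos rfl, if_neg hne'] at heq
          subst heq
          exact absurd h2 (lt_asymm h2')
        · subst h0'
          rw [if_pos rfl, if_neg hne] at heq
          subst heq
          exact absurd h2 (lt_asymm h2')
        · subst h0'
          rw [if_neg hne, if_neg hne'] at heq
          exact ⟨heq, rfl⟩
      · intro w hw
        simp only [Finset.mem_filter, Finset.mem_univ, true_and, decide_eq_true_eq] at hw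
        obtain ⟨hadj, ⟨h, h1⟩ | ⟨h, h1⟩⟩ := hw
        · exact ⟨⟨(v, w), h⟩, by simpa using h1, by simp⟩
        · exact ⟨⟨(w, v), h⟩, by simpa using h1, by simp [hadj.ne']⟩
    rw [hcard]
    exact hc v

/-- colourings of `S` (given as the set of `true` vertices) with no monochromatic edge inside `S` -/
def goodSets {V ι : Type*} [DecidableEq V] [Fintype ι] (E : ι → Finset V) (S : Finset V) :
    Finset (Finset V) :=
  S.powerset.filter (fun T => ∀ j, E j ⊆ S → ¬ (E j ⊆ T) ∧ ¬ Disjoint (E j) T)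

theorem goodSets_chain {V ι : Type*} [DecidableEq V] [Fintype ι] (E : ι → Finset V)
    (N : ℕ) (h : ∀ S : Finset V, S.card < N → ∀ v ∉ S,
      3 * (goodSets E S).card ≤ 2 * (goodSets E (insert v S)).card)
    (A : Finset V) : ∀ U : Finset V, Disjoint U A → (U ∪ A).card ≤ N →
      3 ^ A.card * (goodSets E U).card ≤ 2 ^ A.card * (goodSets E (U ∪ A)).card := by
  induction A using Finset.induction_on with
  | empty => intro U _ _; simp
  | insert v A hv ih =>
    intro U hd hc
    rw [Finset.disjoint_insert_right] at hd
    have hvU : v ∉ U ∪ A := by simp [hd.1, hv]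
    have e : U ∪ insert v A = insert v (U ∪ A) := by
      ext; simp
    rw [e, Finset.card_insert_of_notMem hvU] at hc
    have h1 := ih U hd.2 (by omega)
    have h2 := h (U ∪ A) (by omega) v hvU
    rw [e, Finset.card_insert_of_notMem hv, pow_succ, pow_succ]
    calc 3 ^ A.card * 3 * (goodSets E U).card = 3 * (3 ^ A.card * (goodSets E U).card) := by ring
      _ ≤ 3 * (2 ^ A.card * (goodSets E (U ∪ A)).card) := by gcongr
      _ = 2 ^ A.card * (3 * (goodSets E (U ∪ A)).card) := by ring
      _ ≤ 2 ^ A.card * (2 * (goodSets E (insert v (U ∪ A))).card) := by gcongr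
      _ = _ := by ring

theorem goodSets_step {V ι : Type*} [DecidableEq V] [Fintype ι] (E : ι → Finset V)
    (s D : ℕ) (hs : ∀ j, s + 1 ≤ (E j).card)
    (hD : ∀ v, (Finset.univ.filter (fun j => v ∈ E j)).card ≤ D)
    (hsD : 4 * D * 2 ^ s ≤ 3 ^ s) (N : ℕ) :
    ∀ S : Finset V, S.card = N → ∀ v ∉ S,
      3 * (goodSets E S).card ≤ 2 * (goodSets E (insert v S)).card := by
  induction N using Nat.strong_induction_on with
  | _ N IH =>
  intro S hS v hv
  have hchain := goodSets_chain E N (fun S' h' => IH S'.card h' S' rfl)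
  set C := (goodSets E S).card with hC
  -- candidates
  set K := goodSets E S ∪ (goodSets E S).image (insert v) with hK
  have hsub : ∀ T ∈ goodSets E S, T ⊆ S := fun T hT =>
    Finset.mem_powerset.1 (Finset.mem_filter.1 hT).1
  have hKc : K.card = 2 * C := by
    rw [hK, Finset.card_union_of_disjoint, Finset.card_image_of_injOn, two_mul]
    · intro T hT T' hT' h
      have h1 : v ∉ T := fun h' => hv (hsub T hT h')
      have h2 : v ∉ T' := fun h' => hv (hsub T' hT' h')
      have := congrArg (fun X => Finset.erase X v) h
      simpa [Finset.erase_insert h1, Finset.erase_insert h2] using this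
    · rw [Finset.disjoint_left]
      intro T hT hT'
      obtain ⟨T', _, rfl⟩ := Finset.mem_image.1 hT'
      exact hv (hsub _ hT (Finset.mem_insert_self v T'))
  have hKe : ∀ T ∈ K, T ⊆ insert v S ∧ T.erase v ∈ goodSets E S := by
    intro T hT
    rcases Finset.mem_union.1 hT with h | h
    · have h1 : v ∉ T := fun h' => hv (hsub T h h')
      rw [Finset.erase_eq_of_notMem h1]
      exact ⟨(hsub T h).trans (Finset.subset_insert _ _), h⟩
    · obtain ⟨T', h', rfl⟩ := Finset.mem_image.1 h
      have h1 : v ∉ T' := fun h'' => hv (hsub T' h' h'')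
      rw [Finset.erase_insert h1]
      exact ⟨Finset.insert_subset_insert _ (hsub T' h'), h'⟩
  set J := Finset.univ.filter (fun j => v ∈ E j ∧ E j ⊆ insert v S) with hJ
  have hJc : J.card ≤ D := by
    refine le_trans (Finset.card_le_card ?_) (hD v)
    intro j hj
    simp only [hJ, Finset.mem_filter, Finset.mem_univ, true_and] at hj ⊢
    exact hj.1
  let B1 : ι → Finset (Finset V) := fun j => K.filter (fun T => E j ⊆ T)
  let B2 : ι → Finset (Finset V) := fun j => K.filter (fun T => Disjoint (E j) T)
  have hcov : K ⊆ goodSets E (insert v S) ∪ J.biUnion (fun j => B1 j ∪ B2 j) := by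
    intro T hT
    obtain ⟨h1, h2⟩ := hKe T hT
    by_cases hg : T ∈ goodSets E (insert v S)
    · exact Finset.mem_union_left _ hg
    apply Finset.mem_union_right
    simp only [goodSets, Finset.mem_filter, Finset.mem_powerset, h1, true_and, not_forall] at hg
    obtain ⟨j, hj, hg⟩ := hg
    have hvj : v ∈ E j := by
      by_contra hvj
      apply hg
      have hjS : E j ⊆ S := by
        intro x hx
        rcases Finset.mem_insert.1 (hj hx) with rfl | h
        · exact absurd hx hvj
        · exact h
      have h3 := (Finset.mem_filter.1 h2).2 j hjS
      refine ⟨fun h => h3.1 (fun x hx => Finset.mem_erase.2 ⟨?_, h hx⟩), fun h => h3.2 ?_⟩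
      · rintro rfl; exact hvj hx
      · exact h.mono_right (Finset.erase_subset _ _)
    rw [Finset.mem_biUnion]
    refine ⟨j, by simp [hJ, hvj, hj], ?_⟩
    by_cases h4 : E j ⊆ T
    · exact Finset.mem_union_left _ (Finset.mem_filter.2 ⟨hT, h4⟩)
    · apply Finset.mem_union_right
      refine Finset.mem_filter.2 ⟨hT, ?_⟩
      by_contra h5
      exact hg ⟨h4, h5⟩
  have hsd : ∀ j ∈ J, ∀ T ∈ K, T \ E j ∈ goodSets E (S \ E j) := by
    intro j hj T hT
    simp only [hJ, Finset.mem_filter, Finset.mem_univ, true_and] at hj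
    obtain ⟨h1, h2⟩ := hKe T hT
    refine Finset.mem_filter.2 ⟨Finset.mem_powerset.2 ?_, ?_⟩
    · intro x hx
      rw [Finset.mem_sdiff] at hx ⊢
      rcases Finset.mem_insert.1 (h1 hx.1) with rfl | h
      · exact absurd hj.1 hx.2
      · exact ⟨h, hx.2⟩
    · intro i hi
      have h3 := (Finset.mem_filter.1 h2).2 i (hi.trans Finset.sdiff_subset)
      refine ⟨fun h => h3.1 (fun x hx => Finset.mem_erase.2 ⟨?_, (Finset.mem_sdiff.1 (h hx)).1⟩),
        fun h => h3.2 ?_⟩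
      · rintro rfl; exact hv (Finset.mem_sdiff.1 (hi hx)).1
      · rw [Finset.disjoint_left] at h ⊢
        intro x hx hxT
        exact h hx (Finset.mem_sdiff.2 ⟨(Finset.mem_erase.1 hxT).2, (Finset.mem_sdiff.1 (hi hx)).2⟩)
  have hB1 : ∀ j ∈ J, (B1 j).card ≤ (goodSets E (S \ E j)).card := by
    intro j hj
    apply Finset.card_le_card_of_injOn (fun T => T \ E j)
    · intro T hT
      exact hsd j hj T (Finset.mem_filter.1 hT).1
    · intro T hT T' hT' h
      have h1 := (Finset.mem_filter.1 hT).2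
      have h2 := (Finset.mem_filter.1 hT').2
      rw [← Finset.sdiff_union_of_subset h1, ← Finset.sdiff_union_of_subset h2]
      simp only at h
      rw [h]
  have hB2 : ∀ j ∈ J, (B2 j).card ≤ (goodSets E (S \ E j)).card := by
    intro j hj
    apply Finset.card_le_card_of_injOn (fun T => T \ E j)
    · intro T hT
      exact hsd j hj T (Finset.mem_filter.1 hT).1
    · intro T hT T' hT' h
      have h1 := (Finset.mem_filter.1 hT).2
      have h2 := (Finset.mem_filter.1 hT').2
      simp only at h
      rwa [Finset.sdiff_eq_self_of_disjoint h1.symm, Finset.sdiff_eq_self_of_disjoint h2.symm] at h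
  have hsmall : ∀ j ∈ J, 3 ^ s * (goodSets E (S \ E j)).card ≤ 2 ^ s * C := by
    intro j hj
    simp only [hJ, Finset.mem_filter, Finset.mem_univ, true_and] at hj
    have hcard : s ≤ ((E j).erase v).card := by
      rw [Finset.card_erase_of_mem hj.1]; have := hs j; omega
    have hsubS : (E j).erase v ⊆ S := by
      intro x hx
      rw [Finset.mem_erase] at hx
      rcases Finset.mem_insert.1 (hj.2 hx.2) with h | h
      · exact absurd h hx.1
      · exact h
    have hU : (S \ E j) ∪ (E j).erase v = S := by
      ext x
      simp only [Finset.mem_union, Finset.mem_sdiff, Finset.mem_erase]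
      constructor
      · rintro (h | h)
        · exact h.1
        · exact hsubS (Finset.mem_erase.2 h)
      · intro h
        by_cases hx : x ∈ E j
        · exact Or.inr ⟨fun h' => hv (h' ▸ h), hx⟩
        · exact Or.inl ⟨h, hx⟩
    have h1 := hchain ((E j).erase v) (S \ E j)
      (Finset.disjoint_of_subset_right (Finset.erase_subset _ _) Finset.sdiff_disjoint)
      (by rw [hU, hS])
    rw [hU] at h1
    obtain ⟨c, hc⟩ := Nat.exists_eq_add_of_le hcard
    rw [hc, pow_add, pow_add] at h1
    have h2 : 2 ^ c ≤ 3 ^ c := Nat.pow_le_pow_left (by norm_num) c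
    have h3 : 3 ^ c * (3 ^ s * (goodSets E (S \ E j)).card) ≤ 3 ^ c * (2 ^ s * C) := by
      calc 3 ^ c * (3 ^ s * (goodSets E (S \ E j)).card)
          = 3 ^ s * 3 ^ c * (goodSets E (S \ E j)).card := by ring
        _ ≤ 2 ^ s * 2 ^ c * C := h1
        _ = 2 ^ c * (2 ^ s * C) := by ring
        _ ≤ _ := by gcongr
    exact Nat.le_of_mul_le_mul_left h3 (by positivity)
  have hsum : 3 ^ s * (J.biUnion (fun j => B1 j ∪ B2 j)).card ≤ D * (2 * (2 ^ s * C)) := by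
    calc 3 ^ s * (J.biUnion (fun j => B1 j ∪ B2 j)).card
        ≤ 3 ^ s * ∑ j ∈ J, (B1 j ∪ B2 j).card := by gcongr; exact Finset.card_biUnion_le
      _ = ∑ j ∈ J, 3 ^ s * (B1 j ∪ B2 j).card := by rw [Finset.mul_sum]
      _ ≤ ∑ j ∈ J, 2 * (2 ^ s * C) := by
          apply Finset.sum_le_sum
          intro j hj
          have h1 := Finset.card_union_le (B1 j) (B2 j)
          have h2 := hB1 j hj
          have h3 := hB2 j hj
          calc 3 ^ s * (B1 j ∪ B2 j).card ≤ 3 ^ s * (2 * (goodSets E (S \ E j)).card) := by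
                gcongr; omega
            _ = 2 * (3 ^ s * (goodSets E (S \ E j)).card) := by ring
            _ ≤ _ := by have := hsmall j hj; omega
      _ = J.card * (2 * (2 ^ s * C)) := by simp
      _ ≤ _ := by gcongr
  have h1 : 2 * C ≤ (goodSets E (insert v S)).card + (J.biUnion (fun j => B1 j ∪ B2 j)).card := by
    rw [← hKc]
    exact (Finset.card_le_card hcov).trans (Finset.card_union_le _ _)
  set b := (J.biUnion (fun j => B1 j ∪ B2 j)).card
  have h2 : 3 ^ s * (2 * b) ≤ 3 ^ s * C := by
    calc 3 ^ s * (2 * b) = 2 * (3 ^ s * b) := by ring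
      _ ≤ 2 * (D * (2 * (2 ^ s * C))) := by omega
      _ = (4 * D * 2 ^ s) * C := by ring
      _ ≤ _ := by gcongr
  have h3 := Nat.le_of_mul_le_mul_left h2 (by positivity)
  omega

theorem two_coloring {V ι : Type*} [Fintype V] [DecidableEq V] [Fintype ι] (E : ι → Finset V)
    (s D : ℕ) (hs : ∀ j, s + 1 ≤ (E j).card)
    (hD : ∀ v, (Finset.univ.filter (fun j => v ∈ E j)).card ≤ D)
    (hsD : 4 * D * 2 ^ s ≤ 3 ^ s) :
    ∃ p : V → Bool, ∀ j, ∀ b, ∃ x ∈ E j, p x = b := by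
  have h := goodSets_chain E (Finset.univ : Finset V).card
    (fun S _ => goodSets_step E s D hs hD hsD S.card S rfl) Finset.univ ∅
    (Finset.disjoint_empty_left _) (by simp)
  have h0 : (goodSets E ∅).card = 1 := by
    rw [Finset.card_eq_one]
    refine ⟨∅, ?_⟩
    ext T
    simp only [goodSets, Finset.powerset_empty, Finset.mem_filter, Finset.mem_singleton]
    constructor
    · exact fun h => h.1
    · refine fun h => ⟨h, fun j hj => ?_⟩
      have := hs j
      rw [Finset.subset_empty.1 hj] at this
      simp at this
  rw [h0, Finset.empty_union] at h
  have hpos : 0 < (goodSets E Finset.univ).card := by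
    by_contra hc
    have : (goodSets E Finset.univ).card = 0 := by omega
    rw [this] at h
    have : 0 < 3 ^ (Finset.univ : Finset V).card := by positivity
    omega
  obtain ⟨T, hT⟩ := Finset.card_pos.1 hpos
  refine ⟨fun x => decide (x ∈ T), fun j b => ?_⟩
  have h1 := (Finset.mem_filter.1 hT).2 j (Finset.subset_univ _)
  cases b
  · obtain ⟨x, hx, hxT⟩ := Finset.not_subset.1 h1.1
    exact ⟨x, hx, by simpa using hxT⟩
  · obtain ⟨x, hx, hxT⟩ := Finset.not_disjoint_iff.1 h1.2
    exact ⟨x, hx, by simpa using hxT⟩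

theorem pow_bound (s : ℕ) (hs : 18 ≤ s) : 4 * (2 * s + 3) * 2 ^ s ≤ 3 ^ s := by
  induction s, hs using Nat.le_induction with
  | base => norm_num
  | succ s hs ih =>
    rw [pow_succ, pow_succ]
    have h : 0 < 2 ^ s := by positivity
    nlinarith

theorem split_exists {V : Type*} [Fintype V] [DecidableEq V] (G : SimpleGraph V)
    [DecidableRel G.Adj] (D : ℕ) (hreg : G.IsRegularOfDegree D) (hD : 39 ≤ D)
    (out : V → V → Bool) (dp dm : V → ℕ)
    (hdp : ∀ v, dp v = (Finset.univ.filter (fun w => G.Adj v w ∧ out v w = true)).card)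
    (hdm : ∀ v, dm v = (Finset.univ.filter (fun w => G.Adj v w ∧ out v w = false)).card)
    (h1 : ∀ v, D / 2 ≤ dp v) (h2 : ∀ v, D / 2 ≤ dm v) :
    ∃ p : V → Bool, ∀ v c b, ∃ x, G.Adj v x ∧ out v x = c ∧ p x = b := by
  have key := two_coloring (fun j : V × Bool =>
    Finset.univ.filter (fun w => G.Adj j.1 w ∧ out j.1 w = j.2)) (D / 2 - 1) D ?_ ?_ ?_
  · obtain ⟨p, hp⟩ := key
    refine ⟨p, fun v c b => ?_⟩
    obtain ⟨x, hx, hb⟩ := hp (v, c) b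
    simp only [Finset.mem_filter, Finset.mem_univ, true_and] at hx
    exact ⟨x, hx.1, hx.2, hb⟩
  · rintro ⟨v, c⟩
    have h1 := h1 v
    have h2 := h2 v
    rw [hdp] at h1
    rw [hdm] at h2
    cases c
    · simp only; omega
    · simp only; omega
  · intro x
    rw [← hreg x, ← G.card_neighborFinset_eq_degree]
    apply Finset.card_le_card_of_injOn (fun j => j.1)
    · rintro ⟨v, c⟩ hv
      simp at hv ⊢
      exact hv.1.symm
    · rintro ⟨v, c⟩ hv ⟨v', c'⟩ hv' h
      simp at hv hv' h
      subst h
      simp [← hv.2, ← hv'.2]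
  · have h := pow_bound (D / 2 - 1) (by omega)
    refine le_trans ?_ h
    gcongr
    omega

theorem pal_inj {V : Type*} [DecidableEq V] (W : Finset V) (P : Finset ℕ)
    (hc : W.card ≤ P.card) : ∃ g : V → ℕ, Set.InjOn g W ∧ ∀ w ∈ W, g w ∈ P := by
  obtain ⟨f, hf⟩ := Finset.exists_subset_card_eq hc
  have e : W ≃ f := Finset.equivOfCardEq hf.2.symm
  refine ⟨fun w => if h : w ∈ W then (e ⟨w, h⟩ : ℕ) else 0, ?_, ?_⟩
  · intro x hx y hy h
    have hx' : x ∈ W := hx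
    have hy' : y ∈ W := hy
    simp only [hx', hy', dif_pos] at h
    have := e.injective (Subtype.ext h)
    simpa using this
  · intro w hw
    simp only [hw, dif_pos]
    exact hf.1 (e ⟨w, hw⟩).2

theorem pal_extra {V : Type*} [DecidableEq V] (W : Finset V) (P : Finset ℕ) (z : ℕ)
    (hz : z ∉ P) (x : V) (hx : x ∈ W) (hc : W.card ≤ P.card + 1) :
    ∃ g : V → ℕ, Set.InjOn g W ∧ ∀ w ∈ W, g w ∈ P ∨ (g w = z ∧ P.card < W.card ∧ w = x) := by
  by_cases h : W.card ≤ P.card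
  · obtain ⟨g, hg, hm⟩ := pal_inj W P h
    exact ⟨g, hg, fun w hw => Or.inl (hm w hw)⟩
  · obtain ⟨g, hg, hm⟩ := pal_inj (W.erase x) P (by rw [Finset.card_erase_of_mem hx]; omega)
    refine ⟨fun w => if w = x then z else g w, ?_, ?_⟩
    · intro a ha b hb hab
      have ha' : a ∈ W := ha
      have hb' : b ∈ W := hb
      simp only at hab
      by_cases h1 : a = x <;> by_cases h2 : b = x
      · rw [h1, h2]
      · rw [if_pos h1, if_neg h2] at hab
        exact absurd (hab ▸ hm b (Finset.mem_erase.2 ⟨h2, hb'⟩)) hz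
      · rw [if_neg h1, if_pos h2] at hab
        exact absurd (hab ▸ hm a (Finset.mem_erase.2 ⟨h1, ha'⟩)) hz
      · rw [if_neg h1, if_neg h2] at hab
        exact hg (by simp [h1, ha']) (by simp [h2, hb']) hab
    · intro w hw
      by_cases h1 : w = x
      · right; simp [h1]; omega
      · left; simp only [h1, if_false]; exact hm w (Finset.mem_erase.2 ⟨h1, hw⟩)

theorem pal_hall {V : Type*} [DecidableEq V] (W : Finset V) (P : Finset ℕ) (M : V → ℕ)
    (hc : W.card ≤ P.card) (hne : ∃ x ∈ W, ∃ y ∈ W, M x ≠ M y) :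
    ∃ g : V → ℕ, Set.InjOn g W ∧ ∀ w ∈ W, g w ∈ P ∧ g w ≠ M w := by
  obtain ⟨f, hf, hm⟩ := (Finset.all_card_le_biUnion_card_iff_exists_injective
    (fun w : W => P.erase (M w))).1 (by
      intro S
      rcases S.eq_empty_or_nonempty with rfl | ⟨w, hw⟩
      · simp
      have hSW : S.card ≤ W.card := by
        have := Finset.card_le_univ S
        simpa using this
      by_cases hcst : ∀ y ∈ S, M y = M w
      · have hlt : S.card < W.card := by
          by_contra hcon
          have : S = Finset.univ := Finset.eq_univ_of_card S (by
            rw [Fintype.card_coe]; omega)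
          obtain ⟨x, hx, y, hy, hxy⟩ := hne
          apply hxy
          rw [hcst ⟨x, hx⟩ (by simp [this]), hcst ⟨y, hy⟩ (by simp [this])]
        have h1 : P.erase (M w) ⊆ S.biUnion (fun w : W => P.erase (M w)) :=
          Finset.subset_biUnion_of_mem (fun w : W => P.erase (M w)) hw
        have h2 := Finset.card_le_card h1
        have h3 := Finset.pred_card_le_card_erase (s := P) (a := M w)
        omega
      · push Not at hcst
        obtain ⟨y, hy, hyw⟩ := hcst
        have h1 : P ⊆ S.biUnion (fun w : W => P.erase (M w)) := by
          intro c hcP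
          rw [Finset.mem_biUnion]
          by_cases h : c = M w
          · exact ⟨y, hy, Finset.mem_erase.2 ⟨fun h' => hyw (h'.symm.trans h), hcP⟩⟩
          · exact ⟨w, hw, Finset.mem_erase.2 ⟨h, hcP⟩⟩
        have h2 := Finset.card_le_card h1
        omega)
  refine ⟨fun w => if h : w ∈ W then f ⟨w, h⟩ else 0, ?_, ?_⟩
  · intro x hx y hy h
    have hx' : x ∈ W := hx
    have hy' : y ∈ W := hy
    simp only [hx', hy', dif_pos] at h
    have := hf h
    simpa using this
  · intro w hw
    simp only [hw, dif_pos]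
    have := hm ⟨w, hw⟩
    rw [Finset.mem_erase] at this
    exact ⟨this.2, this.1⟩

theorem half_data {V : Type*} [Fintype V] [DecidableEq V] (G : SimpleGraph V)
    [DecidableRel G.Adj] (D : ℕ) (hreg : G.IsRegularOfDegree D) (hD : 39 ≤ D)
    (hcol : G.Colorable (D / 4)) :
    ∃ (out : V → V → Bool) (hA hB : V → V → ℕ) (M : V → ℕ),
      (∀ u v, G.Adj u v → out v u = !out u v) ∧
      (∀ u v, G.Adj u v → hA u v < D ∧ hA u v ≠ hA v u) ∧
      (∀ u v w, G.Adj u v → G.Adj u w → hA u v = hA u w → v = w) ∧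
      (∀ u v, G.Adj u v → hB u v < D + 1 ∧ hB u v ≠ hB v u ∧ hB u v ≠ M u ∧ hB u v ≠ M v) ∧
      (∀ u v w, G.Adj u v → G.Adj u w → hB u v = hB u w → v = w) ∧
      (∀ u, M u < D + 1) ∧ (∀ u v, G.Adj u v → M u ≠ M v) := by
  obtain ⟨out, hout, hdeg⟩ := orient_graph G D hreg
  obtain ⟨f⟩ := hcol
  let Wp : V → Finset V := fun v => Finset.univ.filter (fun w => G.Adj v w ∧ out v w = true)
  let Wm : V → Finset V := fun v => Finset.univ.filter (fun w => G.Adj v w ∧ out v w = false)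
  have hWp : ∀ v w, w ∈ Wp v ↔ G.Adj v w ∧ out v w = true := by intro v w; simp [Wp]
  have hWm : ∀ v w, w ∈ Wm v ↔ G.Adj v w ∧ out v w = false := by intro v w; simp [Wm]
  have hdeg' : ∀ v, 2 * (Wp v).card ≤ D + 1 ∧ D ≤ 2 * (Wp v).card + 1 := hdeg
  have hsum : ∀ v, (Wp v).card + (Wm v).card = D := by
    intro v
    rw [← hreg v, ← G.card_neighborFinset_eq_degree, ← Finset.card_union_of_disjoint]
    · congr 1
      ext w
      simp only [Finset.mem_union, hWp, hWm, mem_neighborFinset]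
      cases out v w <;> simp
    · rw [Finset.disjoint_left]
      intro w hw hw'
      rw [hWp] at hw
      rw [hWm, hw.2] at hw'
      simp at hw'
  obtain ⟨p, hp⟩ := split_exists G D hreg hD out (fun v => (Wp v).card) (fun v => (Wm v).card)
    (fun v => rfl) (fun v => rfl) (fun v => by have := hdeg' v; omega)
    (fun v => by have := hdeg' v; have := hsum v; omega)
  -- the rows of hA
  have rowA : ∀ v, ∃ g : V → ℕ, (∀ w w', G.Adj v w → G.Adj v w' → g w = g w' → w = w') ∧
      (∀ w, G.Adj v w → g w < D) ∧
      (∀ w, G.Adj v w → out v w = true → g w < D / 2 ∨ (g w = D / 2 ∧ D = 2 * (D / 2) + 1 ∧ p w = p v)) ∧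
      (∀ w, G.Adj v w → out v w = false →
        D - D / 2 ≤ g w ∨ (g w = D / 2 ∧ D = 2 * (D / 2) + 1 ∧ p w ≠ p v)) := by
    intro v
    obtain ⟨x, hx1, hx2, hx3⟩ := hp v true (p v)
    obtain ⟨y, hy1, hy2, hy3⟩ := hp v false (!p v)
    have hd := hdeg' v
    have hs := hsum v
    obtain ⟨gp, hgp, hgpm⟩ := pal_extra (Wp v) (Finset.range (D / 2)) (D / 2) (by simp) x
      ((hWp v x).2 ⟨hx1, hx2⟩) (by rw [Finset.card_range]; omega)
    obtain ⟨gm, hgm, hgmm⟩ := pal_extra (Wm v) (Finset.Ico (D - D / 2) D)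
      (if D = 2 * (D / 2) + 1 then D / 2 else D) (by
        rw [Finset.mem_Ico]; split_ifs <;> omega) y
      ((hWm v y).2 ⟨hy1, hy2⟩) (by rw [Nat.card_Ico]; omega)
    have hP : ∀ w, G.Adj v w → out v w = true →
        gp w < D / 2 ∨ (gp w = D / 2 ∧ D / 2 < (Wp v).card ∧ p w = p v) := by
      intro w h1 h2
      rcases hgpm w ((hWp v w).2 ⟨h1, h2⟩) with h | ⟨h, h', rfl⟩
      · left; simpa using h
      · right; exact ⟨h, by simpa using h', hx3⟩
    have hM : ∀ w, G.Adj v w → out v w = false →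
        (D - D / 2 ≤ gm w ∧ gm w < D) ∨ (gm w = D / 2 ∧ D / 2 < (Wm v).card ∧ p w ≠ p v) := by
      intro w h1 h2
      rcases hgmm w ((hWm v w).2 ⟨h1, h2⟩) with h | ⟨h, h', rfl⟩
      · left; simpa using h
      · right
        rw [Nat.card_Ico] at h'
        refine ⟨?_, by omega, by rw [hy3]; simp⟩
        rw [h, if_pos (by omega)]
    refine ⟨fun w => if out v w = true then gp w else gm w, ?_, ?_, ?_, ?_⟩
    · intro w w' h h' heq
      simp only at heq
      cases ho : out v w <;> cases ho' : out v w' <;>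
        simp only [ho, ho', if_true, Bool.false_eq_true, if_false] at heq
      · exact hgm ((hWm v w).2 ⟨h, ho⟩) ((hWm v w').2 ⟨h', ho'⟩) heq
      · exfalso
        have h1 := hM w h ho
        have h2 := hP w' h' ho'
        omega
      · exfalso
        have h1 := hP w h ho
        have h2 := hM w' h' ho'
        omega
      · exact hgp ((hWp v w).2 ⟨h, ho⟩) ((hWp v w').2 ⟨h', ho'⟩) heq
    · intro w h
      cases ho : out v w <;> simp only [ho, if_true, Bool.false_eq_true, if_false]
      · have := hM w h ho; omega
      · have := hP w h ho; omega
    · intro w h ho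
      simp only [ho, if_true]
      rcases hP w h ho with h1 | ⟨h1, h2, h3⟩
      · exact Or.inl h1
      · exact Or.inr ⟨h1, by omega, h3⟩
    · intro w h ho
      simp only [ho, Bool.false_eq_true, if_false]
      rcases hM w h ho with h1 | ⟨h1, h2, h3⟩
      · exact Or.inl h1.1
      · exact Or.inr ⟨h1, by omega, h3⟩
  choose hA hA1 hA2 hA3 hA4 using rowA
  have hApair : ∀ u v, G.Adj u v → out u v = true → hA u v ≠ hA v u := by
    intro u v h ho heq
    have ho' : out v u = false := by rw [hout u v h, ho]; rfl
    rcases hA3 u v h ho with h1 | ⟨h1, h2, h3⟩ <;>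
      rcases hA4 v u h.symm ho' with h4 | ⟨h4, h5, h6⟩
    · omega
    · omega
    · omega
    · exact h6 h3.symm
  -- the colouring M
  let M : V → ℕ := fun v => (if (Wp v).card < D / 2 + 1 then 0 else D / 2 + 1)
    + 2 * (f v : ℕ) + (p v).toNat
  have hMd : ∀ v, M v = (if (Wp v).card < D / 2 + 1 then 0 else D / 2 + 1)
    + 2 * (f v : ℕ) + (p v).toNat := fun v => rfl
  have hfb : ∀ v, (f v : ℕ) < D / 4 := fun v => (f v).2
  have hpb : ∀ v, (p v).toNat ≤ 1 := fun v => Bool.toNat_le _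
  have hMlt : ∀ u, M u < D + 1 := by
    intro u
    have := hfb u; have := hpb u
    rw [hMd]; split_ifs <;> omega
  have hMeq : ∀ u v, M u = M v → f u = f v ∧ p u = p v := by
    intro u v h
    have := hfb u; have := hpb u
    have := hfb v; have := hpb v
    rw [hMd, hMd] at h
    have h1 : (f u : ℕ) = f v ∧ (p u).toNat = (p v).toNat := by
      split_ifs at h <;> omega
    exact ⟨Fin.ext h1.1, by revert h1; cases p u <;> cases p v <;> simp⟩
  have hMp : ∀ u v, G.Adj u v → M u ≠ M v := by
    intro u v h he
    exact f.valid h (hMeq u v he).1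
  have rowB : ∀ v, ∃ g : V → ℕ, (∀ w w', G.Adj v w → G.Adj v w' → g w = g w' → w = w') ∧
      (∀ w, G.Adj v w → g w < D + 1 ∧ g w ≠ M v ∧ g w ≠ M w) ∧
      (∀ w, G.Adj v w → (out v w = true ↔ g w < D / 2 + 1)) := by
    intro v
    have hd := hdeg' v
    have hs := hsum v
    have hf' := hfb v
    have hp' := hpb v
    have hMv := hMd v
    have hne : ∀ c, ∃ x, (G.Adj v x ∧ out v x = c) ∧ ∃ y, (G.Adj v y ∧ out v y = c) ∧ M x ≠ M y := by
      intro c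
      obtain ⟨x, hx1, hx2, hx3⟩ := hp v c true
      obtain ⟨y, hy1, hy2, hy3⟩ := hp v c false
      refine ⟨x, ⟨hx1, hx2⟩, y, ⟨hy1, hy2⟩, fun h => ?_⟩
      have := (hMeq x y h).2
      rw [hx3, hy3] at this
      simp at this
    obtain ⟨gp, hgp, hgpm⟩ := pal_hall (Wp v) ((Finset.range (D / 2 + 1)).erase (M v)) M (by
        by_cases h : (Wp v).card < D / 2 + 1
        · have := Finset.pred_card_le_card_erase (s := Finset.range (D / 2 + 1)) (a := M v)
          rw [Finset.card_range] at this
          omega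
        · rw [if_neg h] at hMv
          rw [Finset.erase_eq_of_notMem (by rw [Finset.mem_range]; omega), Finset.card_range]
          omega) (by
        obtain ⟨x, hx, y, hy, hxy⟩ := hne true
        exact ⟨x, (hWp v x).2 hx, y, (hWp v y).2 hy, hxy⟩)
    obtain ⟨gm, hgm, hgmm⟩ := pal_hall (Wm v) ((Finset.Ico (D / 2 + 1) (D + 1)).erase (M v)) M (by
        by_cases h : (Wp v).card < D / 2 + 1
        · rw [if_pos h] at hMv
          rw [Finset.erase_eq_of_notMem (by rw [Finset.mem_Ico]; omega), Nat.card_Ico]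
          omega
        · have := Finset.pred_card_le_card_erase (s := Finset.Ico (D / 2 + 1) (D + 1)) (a := M v)
          rw [Nat.card_Ico] at this
          omega) (by
        obtain ⟨x, hx, y, hy, hxy⟩ := hne false
        exact ⟨x, (hWm v x).2 hx, y, (hWm v y).2 hy, hxy⟩)
    have hP : ∀ w, G.Adj v w → out v w = true → gp w < D / 2 + 1 ∧ gp w ≠ M v ∧ gp w ≠ M w := by
      intro w h1 h2
      have := hgpm w ((hWp v w).2 ⟨h1, h2⟩)
      rw [Finset.mem_erase, Finset.mem_range] at this
      exact ⟨this.1.2, this.1.1, this.2⟩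
    have hM : ∀ w, G.Adj v w → out v w = false →
        (D / 2 + 1 ≤ gm w ∧ gm w < D + 1) ∧ gm w ≠ M v ∧ gm w ≠ M w := by
      intro w h1 h2
      have := hgmm w ((hWm v w).2 ⟨h1, h2⟩)
      rw [Finset.mem_erase, Finset.mem_Ico] at this
      exact ⟨this.1.2, this.1.1, this.2⟩
    refine ⟨fun w => if out v w = true then gp w else gm w, ?_, ?_, ?_⟩
    · intro w w' h h' heq
      simp only at heq
      cases ho : out v w <;> cases ho' : out v w' <;>
        simp only [ho, ho', if_true, Bool.false_eq_true, if_false] at heq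
      · exact hgm ((hWm v w).2 ⟨h, ho⟩) ((hWm v w').2 ⟨h', ho'⟩) heq
      · exfalso
        have h1 := hM w h ho
        have h2 := hP w' h' ho'
        omega
      · exfalso
        have h1 := hP w h ho
        have h2 := hM w' h' ho'
        omega
      · exact hgp ((hWp v w).2 ⟨h, ho⟩) ((hWp v w').2 ⟨h', ho'⟩) heq
    · intro w h
      cases ho : out v w <;> simp only [ho, if_true, Bool.false_eq_true, if_false]
      · have := hM w h ho; exact ⟨this.1.2, this.2⟩
      · have := hP w h ho; exact ⟨by omega, this.2⟩
    · intro w h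
      cases ho : out v w <;> simp only [ho, if_true, Bool.false_eq_true, if_false]
      · have := hM w h ho; simp; omega
      · have := hP w h ho; simp; omega
  choose hB hB1 hB2 hB3 using rowB
  refine ⟨out, hA, hB, M, hout, ?_, fun u v w => hA1 u v w, ?_, fun u v w => hB1 u v w,
    hMlt, hMp⟩
  · intro u v h
    refine ⟨hA2 u v h, ?_⟩
    cases ho : out u v
    · have : out v u = true := by rw [hout u v h, ho]; rfl
      exact (hApair v u h.symm this).symm
    · exact hApair u v h ho
  · intro u v h
    refine ⟨(hB2 u v h).1, ?_, (hB2 u v h).2⟩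
    have h1 := hB3 u v h
    have h2 := hB3 v u h.symm
    rw [hout u v h] at h2
    intro he
    rw [he] at h1
    cases ho : out u v <;> simp [ho] at h1 h2 <;> omega

/-- `z` is the branch vertex represented by `(u, v, i)`. -/
def IsBr {V : Type*} (n : ℕ) (u v : V) (i : ℕ) (z : V) : Prop :=
  (i = 0 ∧ z = u) ∨ (i = n ∧ z = v)

/-- Explicit description of when two triples represent the same point. -/
def SameRep {V : Type*} (n : ℕ) (u v : V) (i : ℕ) (a b : V) (j : ℕ) : Prop :=
  (u = a ∧ v = b ∧ i = j) ∨ (u = b ∧ v = a ∧ i + j = n) ∨ ∃ z, IsBr n u v i z ∧ IsBr n a b j z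

theorem mkVert_inj {V : Type*} (G : SimpleGraph V) (n : ℕ) (hn : 0 < n) {u v a b : V}
    (h : G.Adj u v) (h' : G.Adj a b) (i j : ℕ) (hi : i ≤ n) (hj : j ≤ n)
    (he : mkVert G n h i hi = mkVert G n h' j hj) : SameRep n u v i a b j := by
  let F : SubdivVert G n → Prop := Quot.lift
    (fun y : SubdivPre G n => SameRep n u v i y.1.1 y.1.2.1 y.1.2.2) (by
      rintro _ _ (⟨a, b, j, hab, hj⟩ | ⟨a, b, hab⟩)
      · apply propext
        show SameRep n u v i a b j ↔ SameRep n u v i b a (n - j)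
        have hbr : ∀ z, IsBr n a b j z ↔ IsBr n b a (n - j) z := by
          intro z
          unfold IsBr
          have h1 : j = 0 ↔ n - j = n := by omega
          have h2 : j = n ↔ n - j = 0 := by omega
          rw [h1, h2]; tauto
        unfold SameRep
        simp only [hbr]
        have h1 : i = j ↔ i + (n - j) = n := by omega
        have h2 : i + j = n ↔ i = n - j := by omega
        rw [h1, h2]; tauto
      · apply propext
        show SameRep n u v i a b 0 ↔ SameRep n u v i a a 0
        have hbr : ∀ z, IsBr n a b 0 z ↔ z = a := by
          intro z
          unfold IsBr
          constructor
          · rintro (h | h)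
            · exact h.2
            · omega
          · intro h; exact Or.inl ⟨rfl, h⟩
        have hbr' : ∀ z, IsBr n a a 0 z ↔ z = a := by
          intro z
          unfold IsBr
          constructor
          · rintro (h | h) <;> exact h.2
          · intro h; exact Or.inl ⟨rfl, h⟩
        unfold SameRep
        simp only [hbr, hbr']
        constructor
        · rintro (⟨h1, h2, h3⟩ | ⟨h1, h2, h3⟩ | h)
          · exact Or.inr (Or.inr ⟨a, Or.inl ⟨h3, h1.symm⟩, rfl⟩)
          · exact Or.inr (Or.inr ⟨a, Or.inr ⟨h3, h2.symm⟩, rfl⟩)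
          · exact Or.inr (Or.inr h)
        · rintro (⟨h1, h2, h3⟩ | ⟨h1, h2, h3⟩ | h')
          · exact absurd (h1.trans h2.symm) h.ne
          · exact absurd (h1.trans h2.symm) h.ne
          · exact Or.inr (Or.inr h'))
  have h0 : F (mkVert G n h i hi) := Or.inl ⟨rfl, rfl, rfl⟩
  rw [he] at h0
  exact h0

theorem mkVert_flip {V : Type*} (G : SimpleGraph V) (n : ℕ) {u v : V} (h : G.Adj u v)
    (i j : ℕ) (hi : i ≤ n) (hj : j ≤ n) (hij : i + j = n) :
    mkVert G n h i hi = mkVert G n h.symm j hj := by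
  obtain rfl : j = n - i := by omega
  exact Quot.sound (SubdivRel.flip u v i h hi)

theorem mkVert_zero {V : Type*} (G : SimpleGraph V) (n : ℕ) {u v : V} (h : G.Adj u v)
    (h0 : 0 ≤ n) : mkVert G n h 0 h0 = branchVertex G n u :=
  Quot.sound (SubdivRel.collapse u v h)

theorem adj_forward {V : Type*} (G : SimpleGraph V) (n : ℕ) {x y : SubdivVert G n}
    (h : (subdivision G n).Adj x y) : ∃ (a b : V) (h : G.Adj a b) (q : ℕ) (hq : q < n),
      x = mkVert G n h q hq.le ∧ y = mkVert G n h (q + 1) hq := by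
  obtain ⟨_, ⟨u, v, h, i, hi, hx, hy⟩ | ⟨u, v, h, i, hi, hy, hx⟩⟩ := h
  · exact ⟨u, v, h, i, hi, hx, hy⟩
  · refine ⟨v, u, h.symm, n - (i + 1), by omega, ?_, ?_⟩
    · rw [hx]; exact mkVert_flip G n h _ _ _ _ (by omega)
    · rw [hy]; exact mkVert_flip G n h _ _ _ _ (by omega)

/-- `x` and `y` are joined by a short path on one subdivided edge or through one branch vertex. -/
def Near {V : Type*} (G : SimpleGraph V) (n L : ℕ) (x y : SubdivVert G n) : Prop :=
  (∃ (u v : V) (h : G.Adj u v) (p q : ℕ) (hp : p ≤ n) (hq : q ≤ n),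
    x = mkVert G n h p hp ∧ y = mkVert G n h q hq ∧ p ≤ q + L ∧ q ≤ p + L) ∨
  (∃ (u v w : V) (hv : G.Adj u v) (hw : G.Adj u w) (i j : ℕ) (hi : i ≤ n) (hj : j ≤ n),
    v ≠ w ∧ x = mkVert G n hv i hi ∧ y = mkVert G n hw j hj ∧ i + j ≤ L)

theorem near_step {V : Type*} (G : SimpleGraph V) (n L : ℕ) (hL : L < n)
    {x y y' : SubdivVert G n} (hN : Near G n L x y) (hadj : (subdivision G n).Adj y y') :
    Near G n (L + 1) x y' := by
  classical
  obtain ⟨a, b, hab, q, hq, hy, hy'⟩ := adj_forward G n hadj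
  rcases hN with ⟨u, v, h, p, p', hp, hp', hx, hy1, h1, h2⟩ |
      ⟨u, v, w, hv, hw, i, j, hi, hj, hne, hx, hy1, h1⟩
  · rcases mkVert_inj G n (by omega) h hab p' q hp' hq.le (hy1.symm.trans hy) with
      ⟨rfl, rfl, rfl⟩ | ⟨rfl, rfl, h3⟩ | ⟨z, hz1, hz2⟩
    · exact Or.inl ⟨u, v, h, p, p' + 1, hp, hq, hx, hy', by omega, by omega⟩
    · refine Or.inl ⟨u, v, h, p, n - (q + 1), hp, by omega, hx, ?_, by omega, by omega⟩
      rw [hy']; exact mkVert_flip G n hab _ _ _ _ (by omega)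
    · obtain ⟨rfl, rfl⟩ : q = 0 ∧ z = a := by
        rcases hz2 with hz2 | hz2
        · exact hz2
        · omega
      rcases hz1 with ⟨h3, rfl⟩ | ⟨h3, rfl⟩
      · by_cases hb : v = b
        · subst hb
          exact Or.inl ⟨z, v, h, p, 1, hp, hq, hx, hy', by omega, by omega⟩
        · exact Or.inr ⟨z, v, b, h, hab, p, 1, hp, hq, hb, hx, hy', by omega⟩
      · have hx' : x = mkVert G n h.symm (n - p) (by omega) := by
          rw [hx]; exact mkVert_flip G n h _ _ _ _ (by omega)
        by_cases hb : u = b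
        · subst hb
          exact Or.inl ⟨z, u, hab, n - p, 1, by omega, hq, hx', hy', by omega, by omega⟩
        · exact Or.inr ⟨z, u, b, h.symm, hab, n - p, 1, by omega, hq, hb, hx', hy', by omega⟩
  · rcases mkVert_inj G n (by omega) hw hab j q hj hq.le (hy1.symm.trans hy) with
      ⟨rfl, rfl, rfl⟩ | ⟨rfl, rfl, h3⟩ | ⟨z, hz1, hz2⟩
    · exact Or.inr ⟨u, v, w, hv, hw, i, j + 1, hi, hq, hne, hx, hy', by omega⟩
    · refine Or.inr ⟨u, v, w, hv, hw, i, n - (q + 1), hi, by omega, hne, hx, ?_, by omega⟩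
      rw [hy']; exact mkVert_flip G n hab _ _ _ _ (by omega)
    · obtain ⟨rfl, rfl⟩ : q = 0 ∧ z = a := by
        rcases hz2 with hz2 | hz2
        · exact hz2
        · omega
      rcases hz1 with ⟨h3, rfl⟩ | ⟨h3, _⟩
      · by_cases hb : v = b
        · subst hb
          exact Or.inl ⟨z, v, hv, i, 1, hi, hq, hx, hy', by omega, by omega⟩
        · exact Or.inr ⟨z, v, b, hv, hab, i, 1, hi, hq, hb, hx, hy', by omega⟩
      · omega

theorem exists_rep {V : Type*} (G : SimpleGraph V) (n : ℕ) (hdeg : ∀ u, ∃ v, G.Adj u v)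
    (x : SubdivVert G n) : ∃ (u v : V) (h : G.Adj u v) (p : ℕ) (hp : p ≤ n),
      x = mkVert G n h p hp := by
  induction x using Quot.ind with
  | mk x =>
  obtain ⟨⟨u, v, i⟩, ⟨h1, h2⟩ | ⟨h1, h2⟩⟩ := x
  · simp only at h1 h2
    subst h1 h2
    obtain ⟨w, hw⟩ := hdeg u
    exact ⟨u, w, hw, 0, Nat.zero_le n, (mkVert_zero G n hw _).symm⟩
  · exact ⟨u, v, h1, i, h2, rfl⟩

theorem near_of_walk {V : Type*} (G : SimpleGraph V) (n : ℕ) (hdeg : ∀ u, ∃ v, G.Adj u v)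
    {y x : SubdivVert G n} (w : (subdivision G n).Walk y x) (hw : w.length ≤ n) :
    Near G n w.length x y := by
  induction w with
  | nil =>
    rename_i x
    obtain ⟨u, v, h, p, hp, hx⟩ := exists_rep G n hdeg x
    exact Or.inl ⟨u, v, h, p, p, hp, hp, hx, hx, by simp, by simp⟩
  | cons hadj w ih =>
    rw [Walk.length_cons] at hw ⊢
    exact near_step G n _ (by omega) (ih (by omega)) hadj.symm

/-- walk along a subdivided edge -/
theorem walk_from_branch {V : Type*} (G : SimpleGraph V) (n : ℕ) {u v : V} (h : G.Adj u v)
    (i : ℕ) (hi : i ≤ n) :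
    ∃ w : (subdivision G n).Walk (branchVertex G n u) (mkVert G n h i hi), w.length = i := by
  induction i with
  | zero => rw [mkVert_zero]; exact ⟨Walk.nil, rfl⟩
  | succ i ih =>
    obtain ⟨w, hw⟩ := ih (by omega)
    have hadj : (subdivision G n).Adj (mkVert G n h i (by omega)) (mkVert G n h (i + 1) hi) := by
      refine ⟨fun he => ?_, Or.inl ⟨u, v, h, i, hi, rfl, rfl⟩⟩
      have hne := h.ne
      rcases mkVert_inj G n (by omega) h h _ _ _ _ he with
        ⟨_, _, h3⟩ | ⟨h1, _, _⟩ | ⟨z, ⟨h1, h2⟩ | ⟨h1, h2⟩, ⟨h3, h4⟩ | ⟨h3, h4⟩⟩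
      · omega
      · exact hne h1
      · omega
      · exact hne (h2.symm.trans h4)
      · omega
      · omega
    exact ⟨w.concat hadj, by rw [Walk.length_concat, hw]⟩

theorem clique_exists {V : Type*} [Fintype V] [DecidableEq V] (G : SimpleGraph V)
    [DecidableRel G.Adj] (D : ℕ) (hreg : G.IsRegularOfDegree D) (hD : 1 ≤ D) (v₀ : V)
    (k n : ℕ) (hn : 2 * k + 1 < n) :
    ∃ T : Finset (SubdivVert G n), (fracPower G (2 * k + 1) n).IsNClique (D * k + 2) T := by
  classical
  have hpos : 0 < (G.neighborFinset v₀).card := by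
    rw [G.card_neighborFinset_eq_degree, hreg v₀]; omega
  obtain ⟨w₀, hw₀⟩ := Finset.card_pos.1 hpos
  let I : Finset (V × ℕ) := insert (w₀, 0) (insert (w₀, k + 1)
    (G.neighborFinset v₀ ×ˢ Finset.Icc 1 k))
  let pt : V × ℕ → SubdivVert G n := fun q =>
    if h : G.Adj v₀ q.1 ∧ q.2 ≤ n then mkVert G n h.1 q.2 h.2 else branchVertex G n v₀
  have hI : ∀ q ∈ I, G.Adj v₀ q.1 ∧ (q = (w₀, 0) ∨ q = (w₀, k + 1) ∨ (1 ≤ q.2 ∧ q.2 ≤ k)) := by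
    intro q hq
    have hw : G.Adj v₀ w₀ := by simpa using hw₀
    simp only [I, Finset.mem_insert, Finset.mem_product, Finset.mem_Icc, mem_neighborFinset] at hq
    rcases hq with rfl | rfl | h
    · exact ⟨hw, Or.inl rfl⟩
    · exact ⟨hw, Or.inr (Or.inl rfl)⟩
    · exact ⟨h.1, Or.inr (Or.inr h.2)⟩
  have hle : ∀ q ∈ I, q.2 ≤ k + 1 := by
    intro q hq
    rcases (hI q hq).2 with rfl | rfl | h
    · simp
    · simp
    · omega
  have hpt : ∀ q (hq : q ∈ I), pt q = mkVert G n (hI q hq).1 q.2 (by have := hle q hq; omega) := by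
    intro q hq
    have : G.Adj v₀ q.1 ∧ q.2 ≤ n := ⟨(hI q hq).1, by have := hle q hq; omega⟩
    simp only [pt, dif_pos this]
  have hinj : Set.InjOn pt I := by
    intro q hq q' hq' he
    have hq : q ∈ I := hq
    have hq' : q' ∈ I := hq'
    have hl := hle q hq
    have hl' := hle q' hq'
    rw [hpt q hq, hpt q' hq'] at he
    rcases mkVert_inj G n (by omega) _ _ _ _ _ _ he with
        ⟨_, h2, h3⟩ | ⟨h1, _, _⟩ | ⟨z, ⟨h1, h2⟩ | ⟨h1, h2⟩, ⟨h3, h4⟩ | ⟨h3, h4⟩⟩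
    · exact Prod.ext h2 h3
    · exact absurd h1 (hI q' hq').1.ne
    · rcases (hI q hq).2 with h | h | h
      · rcases (hI q' hq').2 with h' | h' | h'
        · rw [h, h']
        · rw [h'] at h3; simp at h3
        · omega
      · rw [h] at h1; simp at h1
      · omega
    · omega
    · omega
    · omega
  refine ⟨I.image pt, ?_, ?_⟩
  · intro x hx y hy hxy
    simp only [Finset.coe_image, Set.mem_image, Finset.mem_coe] at hx hy
    obtain ⟨q, hq, rfl⟩ := hx
    obtain ⟨q', hq', rfl⟩ := hy
    refine ⟨hxy, Or.inl ?_⟩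
    rw [hpt q hq, hpt q' hq']
    obtain ⟨w, hw⟩ := walk_from_branch G n (hI q hq).1 q.2 (by have := hle q hq; omega)
    obtain ⟨w', hw'⟩ := walk_from_branch G n (hI q' hq').1 q'.2 (by have := hle q' hq'; omega)
    refine ⟨w.reverse.append w', ?_⟩
    rw [Walk.length_append, Walk.length_reverse, hw, hw']
    have hl := hle q hq
    have hl' := hle q' hq'
    by_contra hcon
    have e1 : q.2 = k + 1 := by omega
    have e2 : q'.2 = k + 1 := by omega
    apply hxy
    congr 1
    rcases (hI q hq).2 with h | h | h
    · rw [h] at e1; simp at e1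
    · rcases (hI q' hq').2 with h' | h' | h'
      · rw [h'] at e2; simp at e2
      · rw [h, h']
      · omega
    · omega
  · rw [Finset.card_image_of_injOn hinj, Finset.card_insert_of_notMem,
      Finset.card_insert_of_notMem, Finset.card_product, G.card_neighborFinset_eq_degree, hreg v₀]
    · simp
    · simp
    · simp

/-- colour of the point at distance `i` from `u` in the half of the edge `uv` next to `u` -/
def hfc {V : Type*} (k : ℕ) (H Gc : ℕ → V → V → ℕ) (M : V → ℕ) (u v : V) (i : ℕ) : ℕ × ℕ :=
  if i = 0 then (0, 0) else if i ≤ k then (i, H i u v) else if i = k + 1 then (k, M u)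
  else (2 * k + 2 - i, Gc (2 * k + 2 - i) u v)

theorem hfc_cases {V : Type*} (k : ℕ) (H Gc : ℕ → V → V → ℕ) (M : V → ℕ) (u v : V) (i : ℕ) :
    (i = 0 ∧ hfc k H Gc M u v i = (0, 0)) ∨
    (1 ≤ i ∧ i ≤ k ∧ hfc k H Gc M u v i = (i, H i u v)) ∨
    (i = k + 1 ∧ hfc k H Gc M u v i = (k, M u)) ∨
    (k + 2 ≤ i ∧ hfc k H Gc M u v i = (2 * k + 2 - i, Gc (2 * k + 2 - i) u v)) := by
  unfold hfc
  split_ifs with h1 h2 h3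
  · exact Or.inl ⟨h1, rfl⟩
  · exact Or.inr (Or.inl ⟨by omega, h2, rfl⟩)
  · exact Or.inr (Or.inr (Or.inl ⟨h3, rfl⟩))
  · exact Or.inr (Or.inr (Or.inr ⟨by omega, rfl⟩))

/-- The requirements on the level colours. -/
structure LevelData {V : Type*} (G : SimpleGraph V) (k r : ℕ) (H Gc : ℕ → V → V → ℕ)
    (M : V → ℕ) : Prop where
  hh : ∀ i u v, G.Adj u v → H i u v ≠ H i v u
  inj : ∀ i u v w, G.Adj u v → G.Adj u w → H i u v = H i u w → v = w
  gh : ∀ i u v, G.Adj u v → Gc i u v ≠ H i u v ∧ Gc i u v ≠ H i v u ∧ Gc i u v ≠ Gc i v u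
  hm : ∀ u v, G.Adj u v → H k u v ≠ M u ∧ H k u v ≠ M v
  gm : ∀ u v, G.Adj u v → Gc k u v ≠ M u ∧ Gc k u v ≠ M v
  mm : (r = 0 ∧ ∀ u v, M u = M v) ∨
    (1 ≤ r ∧ ∀ u v, G.Adj u v → M u ≠ M v)

theorem hfc_same {V : Type*} {G : SimpleGraph V} {k r : ℕ} {H Gc : ℕ → V → V → ℕ}
    {M : V → ℕ} (hk : 1 ≤ k) (L : LevelData G k r H Gc M) {u v : V} (h : G.Adj u v) {i j : ℕ}
    (hi : i ≤ 2 * k + 1) (hj : j ≤ 2 * k + 1) (hij : i ≠ j) :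
    hfc k H Gc M u v i ≠ hfc k H Gc M u v j := by
  wlog hlt : i < j generalizing i j
  · exact (this hj hi hij.symm (by omega)).symm
  intro he
  rcases hfc_cases k H Gc M u v i with ⟨a1, a⟩ | ⟨a1, a2, a⟩ | ⟨a1, a⟩ | ⟨a1, a⟩ <;>
    rcases hfc_cases k H Gc M u v j with ⟨b1, b⟩ | ⟨b1, b2, b⟩ | ⟨b1, b⟩ | ⟨b1, b⟩ <;>
    rw [a, b, Prod.mk.injEq] at he <;> obtain ⟨e1, e2⟩ := he <;> try omega
  · subst e1
    exact (L.hm u v h).1 e2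
  · subst e1
    exact (L.gh _ u v h).1 e2.symm
  · rw [← e1] at e2
    exact (L.gm u v h).1 e2.symm

theorem hfc_diff {V : Type*} {G : SimpleGraph V} {k r : ℕ} {H Gc : ℕ → V → V → ℕ}
    {M : V → ℕ} (hk : 1 ≤ k) (L : LevelData G k r H Gc M) {u v : V} (h : G.Adj u v) {i j : ℕ}
    (hi : i ≤ 2 * k + 1) (hj : j ≤ 2 * k + 1) (h0 : ¬ (i = 0 ∧ j = 0))
    (h1 : ¬ (i = k + 1 ∧ j = k + 1 ∧ r = 0)) :
    hfc k H Gc M u v i ≠ hfc k H Gc M v u j := by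
  intro he
  rcases hfc_cases k H Gc M u v i with ⟨a1, a⟩ | ⟨a1, a2, a⟩ | ⟨a1, a⟩ | ⟨a1, a⟩ <;>
    rcases hfc_cases k H Gc M v u j with ⟨b1, b⟩ | ⟨b1, b2, b⟩ | ⟨b1, b⟩ | ⟨b1, b⟩ <;>
    rw [a, b, Prod.mk.injEq] at he <;> obtain ⟨e1, e2⟩ := he <;> try omega
  · subst e1
    exact L.hh _ u v h e2
  · subst e1
    exact (L.hm u v h).2 e2
  · subst e1
    exact (L.gh _ v u h.symm).2.1 e2.symm
  · subst e1
    exact (L.hm v u h.symm).2 e2.symm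
  · rcases L.mm with hm | hm
    · exact h1 ⟨a1, b1, hm.1⟩
    · exact hm.2 u v h e2
  · rw [← e1] at e2
    exact (L.gm v u h.symm).2 e2.symm
  · rw [e1] at e2
    exact (L.gh _ u v h).2.1 e2
  · rw [e1] at e2
    exact (L.gm u v h).2 e2
  · rw [e1] at e2
    exact (L.gh _ u v h).2.2 e2

/-- colours on the base edge, of length `2k+2+r` -/
def bc {V : Type*} (k r : ℕ) (H Gc : ℕ → V → V → ℕ) (M : V → ℕ) (u v : V) (i : ℕ) : ℕ × ℕ :=
  if 2 * i ≤ 2 * k + 2 + r then hfc k H Gc M u v i else hfc k H Gc M v u (2 * k + 2 + r - i)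

theorem bc_ne {V : Type*} {G : SimpleGraph V} {k r : ℕ} {H Gc : ℕ → V → V → ℕ}
    {M : V → ℕ} (hk : 1 ≤ k) (hr : r ≤ 2 * k + 1) (L : LevelData G k r H Gc M) {u v : V}
    (h : G.Adj u v) {p q : ℕ} (hpq : p < q) (hq : q ≤ 2 * k + 2 + r)
    (h0 : ¬ (p = 0 ∧ q = 2 * k + 2 + r)) :
    bc k r H Gc M u v p ≠ bc k r H Gc M u v q := by
  unfold bc
  split_ifs with h1 h2 h2
  · exact hfc_same hk L h (by omega) (by omega) (by omega)
  · exact hfc_diff hk L h (by omega) (by omega) (by omega) (by omega)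
  · omega
  · exact hfc_same hk L h.symm (by omega) (by omega) (by omega)

/-- folding a long edge onto the base edge -/
def fold (N Q p : ℕ) : ℕ := if p < Q * N then p % N else p - Q * N

theorem fold_ne {α : Type*} (N Q r : ℕ) (hN : 0 < N) (B : ℕ → α)
    (hB : ∀ p q, p < q → q ≤ N + r → ¬ (p = 0 ∧ q = N + r) → B p ≠ B q) (p q : ℕ)
    (hpq : p < q) (hd : q < p + N) (hq : q ≤ Q * N + N + r) : B (fold N Q p) ≠ B (fold N Q q) := by
  unfold fold
  split_ifs with h1 h2 h2
  · have hp' := Nat.mod_lt p hN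
    have hq' := Nat.mod_lt q hN
    have hne : p % N ≠ q % N := by
      intro he
      have h3 : (q - p) % N = 0 := Nat.sub_mod_eq_zero_of_mod_eq he.symm
      have h4 := Nat.le_of_dvd (by omega) (Nat.dvd_of_mod_eq_zero h3)
      omega
    rcases Nat.lt_or_gt_of_ne hne with h | h
    · exact hB _ _ h (by omega) (by omega)
    · exact (hB _ _ h (by omega) (by omega)).symm
  · obtain ⟨Q', rfl⟩ : ∃ Q', Q = Q' + 1 := by
      rcases Q with _ | Q'
      · simp at h1
      · exact ⟨Q', rfl⟩
    rw [Nat.add_mul, Nat.one_mul] at *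
    obtain ⟨c, hc⟩ : ∃ c, p = Q' * N + c := ⟨p - Q' * N, by omega⟩
    have hmod : p % N = c := by
      rw [hc, Nat.mul_comm, Nat.mul_add_mod, Nat.mod_eq_of_lt (by omega)]
    rw [hmod]
    exact (hB _ _ (by omega) (by omega) (by omega)).symm
  · omega
  · exact hB _ _ (by omega) (by omega) (by omega)

/-- colour of the point `(u, v, p)` -/
def pc {V : Type*} (k r Q n : ℕ) (H Gc : ℕ → V → V → ℕ) (M : V → ℕ) (out : V → V → Bool)
    (u v : V) (p : ℕ) : ℕ × ℕ :=
  if out u v = true then bc k r H Gc M u v (fold (2 * k + 2) Q p)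
  else bc k r H Gc M v u (fold (2 * k + 2) Q (n - p))

theorem pc_ne {V : Type*} {G : SimpleGraph V} {k r Q n : ℕ} {H Gc : ℕ → V → V → ℕ}
    {M : V → ℕ} (out : V → V → Bool) (hk : 1 ≤ k) (hr : r ≤ 2 * k + 1)
    (hn : n = Q * (2 * k + 2) + (2 * k + 2) + r)
    (L : LevelData G k r H Gc M) {u v : V}
    (h : G.Adj u v) {p q : ℕ} (hpq : p ≠ q) (hp : p ≤ n) (hq : q ≤ n)
    (h1 : p ≤ q + (2 * k + 1)) (h2 : q ≤ p + (2 * k + 1)) :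
    pc k r Q n H Gc M out u v p ≠ pc k r Q n H Gc M out u v q := by
  wlog hlt : p < q generalizing p q
  · exact (this hpq.symm hq hp h2 h1 (by omega)).symm
  unfold pc
  split_ifs with ho
  · exact fold_ne (2 * k + 2) Q r (by omega) (bc k r H Gc M u v)
      (fun a b ha hb hc => bc_ne hk hr L h ha hb hc) p q hlt (by omega) (by omega)
  · exact (fold_ne (2 * k + 2) Q r (by omega) (bc k r H Gc M v u)
      (fun a b ha hb hc => bc_ne hk hr L h.symm ha hb hc) (n - q) (n - p)
      (by omega) (by omega) (by omega)).symm

theorem pc_near {V : Type*} {k r Q n : ℕ} {H Gc : ℕ → V → V → ℕ}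
    {M : V → ℕ} (out : V → V → Bool)
    (hn : n = Q * (2 * k + 2) + (2 * k + 2) + r) (u v : V) (i : ℕ) (hi : i ≤ 2 * k + 1) :
    (2 * i ≤ 2 * k + 2 + r ∧ pc k r Q n H Gc M out u v i = hfc k H Gc M u v i) ∨
    (2 * k + 2 + r ≤ 2 * i ∧
      pc k r Q n H Gc M out u v i = hfc k H Gc M v u (2 * k + 2 + r - i)) := by
  have f1 : fold (2 * k + 2) Q i = i := by
    unfold fold
    split_ifs with h
    · exact Nat.mod_eq_of_lt (by omega)
    · rcases Q with _ | Q'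
      · simp
      · rw [Nat.add_mul] at h; omega
  have f2 : fold (2 * k + 2) Q (n - i) = 2 * k + 2 + r - i := by
    unfold fold
    rw [if_neg (by omega)]
    omega
  unfold pc
  rw [f1, f2]
  unfold bc
  split_ifs with h1 h2 h2
  · exact Or.inl ⟨h2, rfl⟩
  · exact Or.inr ⟨by omega, rfl⟩
  · exact Or.inr ⟨by omega, rfl⟩
  · refine Or.inl ⟨by omega, ?_⟩
    congr 1
    omega

theorem pc_zero {V : Type*} {k r Q n : ℕ} {H Gc : ℕ → V → V → ℕ}
    {M : V → ℕ} (out : V → V → Bool)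
    (hn : n = Q * (2 * k + 2) + (2 * k + 2) + r) (u v : V) :
    pc k r Q n H Gc M out u v 0 = (0, 0) := by
  rcases pc_near (H := H) (Gc := Gc) (M := M) out hn u v 0 (by omega) with h | h
  · rw [h.2]; simp [hfc]
  · omega

theorem pc_cross {V : Type*} {G : SimpleGraph V} {k r Q n : ℕ} {H Gc : ℕ → V → V → ℕ}
    {M : V → ℕ} (out : V → V → Bool) (hk : 1 ≤ k) (hr : r ≤ 2 * k + 1)
    (hn : n = Q * (2 * k + 2) + (2 * k + 2) + r)
    (L : LevelData G k r H Gc M) {u v w : V}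
    (hv : G.Adj u v) (hw : G.Adj u w) (hvw : v ≠ w) {i j : ℕ} (hi : 1 ≤ i) (hj : 1 ≤ j)
    (hij : i + j ≤ 2 * k + 1) :
    pc k r Q n H Gc M out u v i ≠ pc k r Q n H Gc M out u w j := by
  wlog hlt : j ≤ i generalizing i j v w
  · exact (this hw hv hvw.symm hj hi (by omega) (by omega)).symm
  have hjc : pc k r Q n H Gc M out u w j = (j, H j u w) := by
    rcases pc_near (H := H) (Gc := Gc) (M := M) out hn u w j (by omega) with h | h
    · rw [h.2]
      rcases hfc_cases k H Gc M u w j with ⟨a1, a⟩ | ⟨a1, a2, a⟩ | ⟨a1, a⟩ | ⟨a1, a⟩ <;>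
        first | exact a | omega
    · omega
  rw [hjc]
  intro he
  rcases pc_near (H := H) (Gc := Gc) (M := M) out hn u v i (by omega) with ⟨h1, h2⟩ | ⟨h1, h2⟩
  · rw [h2] at he
    rcases hfc_cases k H Gc M u v i with ⟨a1, a⟩ | ⟨a1, a2, a⟩ | ⟨a1, a⟩ | ⟨a1, a⟩ <;>
      rw [a, Prod.mk.injEq] at he <;> obtain ⟨e1, e2⟩ := he <;> try omega
    · subst e1
      exact hvw (L.inj i u v w hv hw e2)
    · subst e1
      exact (L.hm u w hw).1 e2.symm
  · rw [h2] at he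
    rcases hfc_cases k H Gc M v u (2 * k + 2 + r - i) with
      ⟨a1, a⟩ | ⟨a1, a2, a⟩ | ⟨a1, a⟩ | ⟨a1, a⟩ <;>
      rw [a, Prod.mk.injEq] at he <;> obtain ⟨e1, e2⟩ := he <;> try omega
    subst e1
    rcases L.mm with hm | hm
    · rw [hm.2 v u] at e2
      exact (L.hm u w hw).1 e2.symm
    · have h3 := hm.1
      omega

theorem mirror_exists {V : Type*} (G : SimpleGraph V) (D : ℕ) (hD : 39 ≤ D)
    (out : V → V → Bool) (hout : ∀ u v, G.Adj u v → out v u = !out u v)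
    (H : ℕ → V → V → ℕ) (M : V → ℕ) :
    ∃ Gc : ℕ → V → V → ℕ, ∀ i u v, G.Adj u v →
      Gc i u v < D ∧ Gc i u v ≠ H i u v ∧ Gc i u v ≠ H i v u ∧ Gc i u v ≠ Gc i v u ∧
      Gc i u v ≠ M u ∧ Gc i u v ≠ M v := by
  classical
  have key : ∀ (i : ℕ) (u v : V), ∃ a b : ℕ, a ≠ b ∧
      (a < D ∧ a ≠ H i u v ∧ a ≠ H i v u ∧ a ≠ M u ∧ a ≠ M v) ∧
      (b < D ∧ b ≠ H i u v ∧ b ≠ H i v u ∧ b ≠ M u ∧ b ≠ M v) := by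
    intro i u v
    let F : Finset ℕ := Finset.range D \ {H i u v, H i v u, M u, M v}
    have h1 : 1 < F.card := by
      have h2 := Finset.le_card_sdiff ({H i u v, H i v u, M u, M v} : Finset ℕ) (Finset.range D)
      have h3 : ({H i u v, H i v u, M u, M v} : Finset ℕ).card ≤ 4 := Finset.card_le_four
      rw [Finset.card_range] at h2
      show 1 < (Finset.range D \ {H i u v, H i v u, M u, M v}).card
      omega
    obtain ⟨a, ha, b, hb, hab⟩ := Finset.one_lt_card.1 h1
    simp only [F, Finset.mem_sdiff, Finset.mem_range, Finset.mem_insert, Finset.mem_singleton,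
      not_or] at ha hb
    exact ⟨a, b, hab, ⟨ha.1, ha.2⟩, ⟨hb.1, hb.2⟩⟩
  choose fa fb hne ha hb using key
  refine ⟨fun i u v => if out u v = true then fa i u v else fb i v u, ?_⟩
  intro i u v h
  have ho := hout u v h
  simp only
  cases hc : out u v with
  | true =>
    rw [hc] at ho
    simp only [Bool.not_true] at ho
    simp only [ho, if_true, Bool.false_eq_true, if_false]
    exact ⟨(ha i u v).1, (ha i u v).2.1, (ha i u v).2.2.1, hne i u v, (ha i u v).2.2.2.1,
      (ha i u v).2.2.2.2⟩
  | false =>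
    rw [hc] at ho
    simp only [Bool.not_false] at ho
    simp only [ho, if_true, Bool.false_eq_true, if_false]
    exact ⟨(hb i v u).1, (hb i v u).2.2.1, (hb i v u).2.1, (hne i v u).symm,
      (hb i v u).2.2.2.2, (hb i v u).2.2.2.1⟩

theorem level_exists {V : Type*} [Fintype V] [DecidableEq V] (G : SimpleGraph V)
    [DecidableRel G.Adj] (D : ℕ) (hreg : G.IsRegularOfDegree D) (hD : 39 ≤ D)
    (hcol : G.Colorable (D / 4)) (k r : ℕ) :
    ∃ (out : V → V → Bool) (H Gc : ℕ → V → V → ℕ) (M : V → ℕ),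
      (∀ u v, G.Adj u v → out v u = !out u v) ∧ LevelData G k r H Gc M ∧
      (∀ i u v, G.Adj u v → i ≠ k → H i u v < D) ∧
      (∀ u v, G.Adj u v → H k u v < D + 1) ∧
      (∀ i u v, G.Adj u v → Gc i u v < D) ∧ (∀ u, M u < D + 1) := by
  obtain ⟨out, hA, hB, M, hout, hA1, hA2, hB1, hB2, hM1, hM2⟩ := half_data G D hreg hD hcol
  by_cases hr : r = 0
  · obtain ⟨Gc, hG⟩ := mirror_exists G D hD out hout (fun _ => hA) (fun _ => D)
    refine ⟨out, fun _ => hA, Gc, fun _ => D, hout, ⟨?_, ?_, ?_, ?_, ?_, ?_⟩, ?_, ?_, ?_, ?_⟩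
    · exact fun i u v h => (hA1 u v h).2
    · exact fun i => hA2
    · exact fun i u v h => ⟨(hG i u v h).2.1, (hG i u v h).2.2.1, (hG i u v h).2.2.2.1⟩
    · exact fun u v h => ⟨(hA1 u v h).1.ne, (hA1 u v h).1.ne⟩
    · exact fun u v h => ⟨(hG k u v h).2.2.2.2.1, (hG k u v h).2.2.2.2.2⟩
    · exact Or.inl ⟨hr, fun _ _ => rfl⟩
    · exact fun i u v h _ => (hA1 u v h).1
    · exact fun u v h => Nat.lt_succ_of_lt (hA1 u v h).1
    · exact fun i u v h => (hG i u v h).1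
    · exact fun u => Nat.lt_succ_self D
  · obtain ⟨Gc, hG⟩ := mirror_exists G D hD out hout (fun i => if i = k then hB else hA) M
    refine ⟨out, fun i => if i = k then hB else hA, Gc, M, hout,
      ⟨?_, ?_, ?_, ?_, ?_, ?_⟩, ?_, ?_, ?_, ?_⟩
    · intro i u v h
      by_cases hi : i = k
      · simp only [hi, if_true]; exact (hB1 u v h).2.1
      · simp only [hi, if_false]; exact (hA1 u v h).2
    · intro i u v w h h'
      by_cases hi : i = k
      · simp only [hi, if_true]; exact hB2 u v w h h'
      · simp only [hi, if_false]; exact hA2 u v w h h'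
    · exact fun i u v h => ⟨(hG i u v h).2.1, (hG i u v h).2.2.1, (hG i u v h).2.2.2.1⟩
    · intro u v h
      simp only [if_true]
      exact (hB1 u v h).2.2
    · exact fun u v h => ⟨(hG k u v h).2.2.2.2.1, (hG k u v h).2.2.2.2.2⟩
    · exact Or.inr ⟨by omega, hM2⟩
    · intro i u v h hi
      simp only [hi, if_false]
      exact (hA1 u v h).1
    · intro u v h
      simp only [if_true]
      exact (hB1 u v h).1
    · exact fun i u v h => (hG i u v h).1
    · exact hM1

/-- the set of colours -/
def palette (D k : ℕ) : Finset (ℕ × ℕ) :=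
  insert (0, 0) (insert (k, D) (Finset.Icc 1 k ×ˢ Finset.range D))

theorem palette_card (D k : ℕ) : (palette D k).card ≤ D * k + 2 := by
  unfold palette
  refine (Finset.card_insert_le _ _).trans ?_
  refine (Nat.succ_le_succ (Finset.card_insert_le _ _)).trans ?_
  rw [Finset.card_product, Nat.card_Icc, Finset.card_range, Nat.mul_comm]
  simp

theorem mem_palette {D k i c : ℕ} (hi : 1 ≤ i) (hk : i ≤ k) (h1 : i ≠ k → c < D)
    (h2 : c < D + 1) : (i, c) ∈ palette D k := by
  unfold palette
  simp only [Finset.mem_insert, Prod.mk.injEq, Finset.mem_product, Finset.mem_Icc,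
    Finset.mem_range]
  by_cases hik : i = k <;> by_cases hc : c = D
  · exact Or.inr (Or.inl ⟨hik, hc⟩)
  · exact Or.inr (Or.inr ⟨⟨hi, hk⟩, by omega⟩)
  · exact absurd hc (h1 hik).ne
  · exact Or.inr (Or.inr ⟨⟨hi, hk⟩, by omega⟩)

theorem hfc_mem {V : Type*} {G : SimpleGraph V} {D k : ℕ} (hk : 1 ≤ k) {H Gc : ℕ → V → V → ℕ}
    {M : V → ℕ} (b1 : ∀ i u v, G.Adj u v → i ≠ k → H i u v < D)
    (b2 : ∀ u v, G.Adj u v → H k u v < D + 1)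
    (b3 : ∀ i u v, G.Adj u v → Gc i u v < D) (b4 : ∀ u, M u < D + 1)
    {u v : V} (h : G.Adj u v) (i : ℕ) (hi : i ≤ 2 * k + 1) :
    hfc k H Gc M u v i ∈ palette D k := by
  rcases hfc_cases k H Gc M u v i with ⟨a1, a⟩ | ⟨a1, a2, a⟩ | ⟨a1, a⟩ | ⟨a1, a⟩ <;> rw [a]
  · simp [palette]
  · refine mem_palette a1 a2 (b1 i u v h) ?_
    by_cases hik : i = k
    · rw [hik]; exact b2 u v h
    · exact Nat.lt_succ_of_lt (b1 i u v h hik)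
  · exact mem_palette hk le_rfl (fun h => absurd rfl h) (b4 u)
  · exact mem_palette (by omega) (by omega) (fun _ => b3 _ u v h)
      (Nat.lt_succ_of_lt (b3 _ u v h))

theorem fold_le (N Q r p : ℕ) (hN : 0 < N) (hp : p ≤ Q * N + N + r) : fold N Q p ≤ N + r := by
  unfold fold
  split_ifs with h
  · have := Nat.mod_lt p hN
    omega
  · omega

theorem pc_mem {V : Type*} {G : SimpleGraph V} {D k r Q n : ℕ} (hk : 1 ≤ k)
    (hr : r ≤ 2 * k + 1) (hn : n = Q * (2 * k + 2) + (2 * k + 2) + r) {H Gc : ℕ → V → V → ℕ}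
    {M : V → ℕ} (out : V → V → Bool) (b1 : ∀ i u v, G.Adj u v → i ≠ k → H i u v < D)
    (b2 : ∀ u v, G.Adj u v → H k u v < D + 1)
    (b3 : ∀ i u v, G.Adj u v → Gc i u v < D) (b4 : ∀ u, M u < D + 1)
    {u v : V} (h : G.Adj u v) (p : ℕ) (hp : p ≤ n) :
    pc k r Q n H Gc M out u v p ∈ palette D k := by
  have f1 := fold_le (2 * k + 2) Q r p (by omega) (by omega)
  have f2 := fold_le (2 * k + 2) Q r (n - p) (by omega) (by omega)
  unfold pc bc
  split_ifs with h1 h2 h2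
  · exact hfc_mem hk b1 b2 b3 b4 h _ (by omega)
  · exact hfc_mem hk b1 b2 b3 b4 h.symm _ (by omega)
  · exact hfc_mem hk b1 b2 b3 b4 h.symm _ (by omega)
  · exact hfc_mem hk b1 b2 b3 b4 h _ (by omega)

theorem frac_colorable {V : Type*} [Fintype V] [DecidableEq V] (G : SimpleGraph V)
    [DecidableRel G.Adj] (D : ℕ) (hreg : G.IsRegularOfDegree D) (hD : 39 ≤ D)
    (hcol : G.Colorable (D / 4)) (k n : ℕ) (hk : 1 ≤ k) (hkn : 2 * k + 1 < n) :
    (fracPower G (2 * k + 1) n).Colorable (D * k + 2) := by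
  have hdeg : ∀ u, ∃ v, G.Adj u v := by
    intro u
    have hpos : 0 < (G.neighborFinset u).card := by
      rw [G.card_neighborFinset_eq_degree, hreg u]; omega
    obtain ⟨w, hw⟩ := Finset.card_pos.1 hpos
    exact ⟨w, by simpa using hw⟩
  obtain ⟨Q, r, hr, hn⟩ : ∃ Q r, r ≤ 2 * k + 1 ∧ n = Q * (2 * k + 2) + (2 * k + 2) + r := by
    refine ⟨(n - (2 * k + 2)) / (2 * k + 2), (n - (2 * k + 2)) % (2 * k + 2), ?_, ?_⟩
    · have := Nat.mod_lt (n - (2 * k + 2)) (show 2 * k + 2 > 0 by omega)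
      omega
    · have := Nat.div_add_mod (n - (2 * k + 2)) (2 * k + 2)
      rw [Nat.mul_comm] at this
      omega
  obtain ⟨out, H, Gc, M, hout, L, b1, b2, b3, b4⟩ := level_exists G D hreg hD hcol k r
  let c : SubdivVert G n → ℕ × ℕ := Quot.lift
    (fun x : SubdivPre G n => pc k r Q n H Gc M out x.1.1 x.1.2.1 x.1.2.2) (by
      rintro _ _ (⟨a, b, j, hab, hj⟩ | ⟨a, b, hab⟩)
      · show pc k r Q n H Gc M out a b j = pc k r Q n H Gc M out b a (n - j)
        have ho := hout a b hab
        have hnn : n - (n - j) = j := by omega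
        unfold pc
        rw [hnn]
        cases hc : out a b with
        | true =>
          rw [hc] at ho
          simp [ho]
        | false =>
          rw [hc] at ho
          simp [ho]
      · show pc k r Q n H Gc M out a b 0 = pc k r Q n H Gc M out a a 0
        rw [pc_zero out hn, pc_zero out hn])
  have hc : ∀ (u v : V) (h : G.Adj u v) (i : ℕ) (hi : i ≤ n),
      c (mkVert G n h i hi) = pc k r Q n H Gc M out u v i := fun _ _ _ _ _ => rfl
  have hmem : ∀ x, c x ∈ palette D k := by
    intro x
    obtain ⟨u, v, h, p, hp, rfl⟩ := exists_rep G n hdeg x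
    rw [hc]
    exact pc_mem hk hr hn out b1 b2 b3 b4 h p hp
  have hnear : ∀ (l : ℕ) (x y : SubdivVert G n), l ≤ 2 * k + 1 → x ≠ y → Near G n l x y →
      c x ≠ c y := by
    rintro l x y hl hxy (⟨u, v, h, p, q, hp, hq, rfl, rfl, h1, h2⟩ |
      ⟨u, v, w, hv, hw, i, j, hi, hj, hvw, rfl, rfl, hij⟩)
    · rw [hc, hc]
      refine pc_ne out hk hr hn L h ?_ hp hq (by omega) (by omega)
      rintro rfl
      exact hxy rfl
    · rw [hc, hc]
      by_cases hi0 : i = 0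
      · subst hi0
        rw [pc_zero out hn, ← pc_zero (H := H) (Gc := Gc) (M := M) out hn u w]
        refine pc_ne out hk hr hn L hw ?_ (by omega) hj (by omega) (by omega)
        rintro rfl
        exact hxy (by rw [mkVert_zero, mkVert_zero])
      · by_cases hj0 : j = 0
        · subst hj0
          rw [pc_zero out hn u w, ← pc_zero (H := H) (Gc := Gc) (M := M) out hn u v]
          exact pc_ne out hk hr hn L hv hi0 hi (by omega) (by omega) (by omega)
        · exact pc_cross out hk hr hn L hv hw hvw (by omega) (by omega) (by omega)
  have hproper : ∀ {x y : SubdivVert G n}, (fracPower G (2 * k + 1) n).Adj x y → c x ≠ c y := by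
    rintro x y ⟨hxy, ⟨w, hw⟩ | ⟨w, hw⟩⟩
    · exact (hnear _ y x hw hxy.symm (near_of_walk G n hdeg w (by omega))).symm
    · exact hnear _ x y hw hxy (near_of_walk G n hdeg w (by omega))
  let C : (fracPower G (2 * k + 1) n).Coloring (palette D k) :=
    Coloring.mk (fun x => ⟨c x, hmem x⟩) (by
      intro x y hxy he
      exact hproper hxy (congrArg Subtype.val he))
  have hC := C.colorable
  rw [Fintype.card_coe] at hC
  exact hC.mono (palette_card D k)

theorem chromatic_eq_clique_of_regular_dynamic {V : Type*} [Fintype V] (G : SimpleGraph V)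
    [DecidableRel G.Adj] (Δ : ℕ) (hreg : G.IsRegularOfDegree Δ) (hΔ : 39 ≤ Δ)
    (hχ : G.chromaticNumber ≤ ((Δ / 4 : ℕ) : ℕ∞))
    (m n : ℕ) (hm : Odd m) (h1m : 1 < m) (hmn : m < n) :
    (fracPower G m n).chromaticNumber = (fracPower G m n).cliqueNum := by
  classical
  obtain ⟨k, rfl⟩ := hm
  have hcol : G.Colorable (Δ / 4) := chromaticNumber_le_iff_colorable.1 hχ
  have hC := frac_colorable G Δ hreg hΔ hcol k n (by omega) hmn
  have hbound : ∀ (s : Finset (SubdivVert G n)) (a : ℕ),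
      (fracPower G (2 * k + 1) n).IsNClique a s → a ≤ Δ * k + 2 := by
    intro s a hs
    rw [← hs.card_eq]
    exact hs.isClique.card_le_of_colorable hC
  rcases isEmpty_or_nonempty V with hV | ⟨⟨v₀⟩⟩
  · have hE : IsEmpty (SubdivVert G n) := by
      refine ⟨fun x => ?_⟩
      induction x using Quot.ind with
      | mk x => exact hV.elim x.1.1
    have h0 : (fracPower G (2 * k + 1) n).chromaticNumber = 0 :=
      chromaticNumber_eq_zero_of_isEmpty
    rw [h0]
    have h1 : (fracPower G (2 * k + 1) n).cliqueNum = 0 := by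
      unfold SimpleGraph.cliqueNum
      have : {a | ∃ s, (fracPower G (2 * k + 1) n).IsNClique a s} ⊆ {0} := by
        rintro a ⟨s, hs⟩
        have h2 := hs.card_eq
        rw [Finset.eq_empty_of_isEmpty s, Finset.card_empty] at h2
        exact h2.symm
      rcases Set.subset_singleton_iff_eq.1 this with h | h <;> rw [h] <;> simp
    rw [h1]
    rfl
  · obtain ⟨T, hT⟩ := clique_exists G Δ hreg (by omega) v₀ k n hmn
    have h1 : (fracPower G (2 * k + 1) n).cliqueNum = Δ * k + 2 := by
      unfold SimpleGraph.cliqueNum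
      apply le_antisymm
      · exact csSup_le' (fun a ⟨s, hs⟩ => hbound s a hs)
      · exact le_csSup ⟨Δ * k + 2, fun a ⟨s, hs⟩ => hbound s a hs⟩ ⟨T, hT⟩
    rw [h1]
    apply le_antisymm
    · exact hC.chromaticNumber_le
    · have h2 := hT.isClique.card_le_chromaticNumber
      rw [hT.card_eq] at h2
      exact h2
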